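/- Let G be a countable discrete infinite amenable group acting continuously on a compact metric space (X,d), let μ be a G-invariant Borel probability measure on X with ergodic decomposition μ = ∫_Y μ_y dπ(y) over Y = X/I_μ with projection p : X → Y, and let h(y) = h_{μ_y}(p^{-1}(y),G). Let {F_n} be a tempered Følner sequence in G with lim_{n→∞} |F_n|/log n = ∞. Then for every M > 0, with X_M = p^{-1}(h^{-1}([0,M))), one has ∫_{X_M} lim_{δ→0} liminf_{n→∞} −(1/|F_n|) log μ(B_{F_n}(x,δ)) dμ(x) ≥ ∫_{h^{-1}([0,M))} h(y) dπ(y). -/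

import Mathlib

open MeasureTheory Filter Set
open scoped Pointwise ENNReal NNReal Topology

section Defs

variable {G : Type*} [Group G] [DecidableEq G] {X : Type*}

/-- A Følner sequence: a sequence of nonempty finite subsets of `G` that is asymptotically
invariant: `|Fₙ △ gFₙ|/|Fₙ| → 0` for every `g ∈ G`. -/
def IsFolnerSeq (F : ℕ → Finset G) : Prop :=
  (∀ n, (F n).Nonempty) ∧
    ∀ g : G, Tendsto (fun n => ((symmDiff (F n) ((F n).image (g * ·))).card : ℝ) / (F n).card)
      atTop (𝓝 0)

/-- A sequence of finite subsets is tempered if `|⋃_{k<n} Fₖ⁻¹ Fₙ| ≤ C |Fₙ|` for a constant `C`. -/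
def IsTemperedSeq (F : ℕ → Finset G) : Prop :=
  ∃ C : ℝ, ∀ n : ℕ, (((Finset.range n).biUnion fun k => (F k)⁻¹ * F n).card : ℝ) ≤ C * (F n).card

/-- The growth condition `|Fₙ|/log n → ∞`. -/
def GrowthCond (F : ℕ → Finset G) : Prop :=
  Tendsto (fun n => ((F n).card : ℝ) / Real.log n) atTop atTop

variable [MetricSpace X] [MulAction G X]

/-- The Bowen ball `B_F(x,ε) = {y : d(gx, gy) < ε for all g ∈ F}`. -/
def bowenBall (F : Finset G) (x : X) (ε : ℝ) : Set X :=
  {y | ∀ g ∈ F, dist (g • x) (g • y) < ε}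

/-- `M(Z,N,ε,s,{Fₙ})`: infimum of `Σᵢ exp(-s |F_{nᵢ}|)` over countable families of Bowen balls
`B_{F_{nᵢ}}(xᵢ,ε)` with `nᵢ ≥ N` covering `Z`. -/
noncomputable def bowenMpre (F : ℕ → Finset G) (Z : Set X) (N : ℕ) (ε s : ℝ) : ℝ≥0∞ :=
  ⨅ (C : Set (X × ℕ)) (_ : C.Countable ∧ (∀ p ∈ C, N ≤ p.2) ∧
      Z ⊆ ⋃ p ∈ C, bowenBall (F p.2) p.1 ε),
    ∑' p : C, ENNReal.ofReal (Real.exp (-s * ((F (p : X × ℕ).2).card : ℝ)))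

/-- `M(Z,s,{Fₙ}) = lim_{ε→0} lim_{N→∞} M(Z,N,ε,s,{Fₙ})`; since the quantity is monotone
(nondecreasing as `N` increases and as `ε` decreases), the limits are suprema. -/
noncomputable def bowenMeasure (F : ℕ → Finset G) (Z : Set X) (s : ℝ) : ℝ≥0∞ :=
  ⨆ (ε : ℝ) (_ : 0 < ε), ⨆ N : ℕ, bowenMpre F Z N ε s

/-- The Bowen topological entropy of `Z` along `{Fₙ}`: the critical value of `s` at which
`M(Z,s,{Fₙ})` jumps from `+∞` to `0`. -/
noncomputable def bowenEntropy (F : ℕ → Finset G) (Z : Set X) : ℝ≥0∞ :=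
  ⨆ (s : ℝ) (_ : bowenMeasure F Z s = ⊤), ENNReal.ofReal s

/-- The minimal cardinality of a subcover of `⋁_{g ∈ F} g⁻¹ U` for a cover `U`. -/
noncomputable def coverNumber (U : Finset (Set X)) (F : Finset G) : ℕ :=
  sInf {k : ℕ | ∃ f : Fin k → G → Set X, (∀ i, ∀ g ∈ F, f i g ∈ U) ∧
    (univ : Set X) ⊆ ⋃ i, ⋂ g ∈ F, (fun x => g • x) ⁻¹' f i g}

/-- The topological entropy of the `G`-action on `X` (computed along `{Fₙ}`; it is independent
of the Følner sequence). -/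
noncomputable def topEntropy (X : Type*) [MetricSpace X] {G : Type*} [Group G] [MulAction G X]
    (F : ℕ → Finset G) : ℝ≥0∞ :=
  ⨆ (U : Finset (Set X)) (_ : (∀ V ∈ U, IsOpen V) ∧ ⋃₀ (U : Set (Set X)) = univ),
    limsup (fun n => ENNReal.ofReal (Real.log (coverNumber U (F n)) / (F n).card)) atTop

end Defs

section MeasDefs

variable {G : Type*} [Group G] [DecidableEq G] {X : Type*} [MeasurableSpace X] [MulAction G X]

/-- The Shannon entropy `H_μ(⋁_{g∈F} g⁻¹ P)` of the join over `F` of the finite measurable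
partition `P` given by the fibers of `α`. -/
noncomputable def partitionEntropy (μ : Measure X) {ι : Type*} [Fintype ι] (α : X → ι)
    (F : Finset G) : ℝ :=
  ∑ f : ↥F → ι, Real.negMulLog ((μ {x | ∀ g : ↥F, α ((g : G) • x) = f g}).toReal)

/-- The entropy `h_μ(G,P) = lim_n H_μ(P^{Fₙ})/|Fₙ|` of the partition given by the fibers
of `α` (the limit existing, it is the `limsup`). -/
noncomputable def partitionDynEntropy (F : ℕ → Finset G) (μ : Measure X) {ι : Type*} [Fintype ι]
    (α : X → ι) : ℝ :=
  limsup (fun n => partitionEntropy μ α (F n) / (F n).card) atTop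

/-- The measure-theoretic entropy `h_μ(X,G)`: the supremum over finite measurable partitions
(encoded as measurable maps `X → Fin k`) of `lim_n H_μ(P^{Fₙ})/|Fₙ|`. -/
noncomputable def measEntropy (F : ℕ → Finset G) (μ : Measure X) : ℝ≥0∞ :=
  ⨆ (k : ℕ) (α : X → Fin k) (_ : Measurable α),
    limsup (fun n => ENNReal.ofReal (partitionEntropy μ α (F n) / (F n).card)) atTop

/-- `μ` is `G`-invariant. -/
def InvariantMeasure (G : Type*) [Group G] [MulAction G X] (μ : Measure X) : Prop :=
  ∀ g : G, Measure.map (fun x => g • x) μ = μ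

/-- `μ` is ergodic: every Borel set `A` with `μ(A △ g⁻¹A) = 0` for all `g` is trivial. -/
def ErgodicMeasure (G : Type*) [Group G] [MulAction G X] (μ : Measure X) : Prop :=
  ∀ A : Set X, MeasurableSet A →
    (∀ g : G, μ (symmDiff A ((fun x => g • x) ⁻¹' A)) = 0) → μ A = 0 ∨ μ A = 1

end MeasDefs

section LocalDefs

variable {G : Type*} [Group G] [DecidableEq G] {X : Type*} [MetricSpace X] [MulAction G X]
  [MeasurableSpace X]

/-- The set of generic points of `μ` with respect to `{Fₙ}`. -/
def genericPointSet (F : ℕ → Finset G) (μ : Measure X) : Set X :=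
  {x | ∀ f : C(X, ℝ),
    Tendsto (fun n => (∑ g ∈ F n, f (g • x)) / (F n).card) atTop (𝓝 (∫ y, f y ∂μ))}

/-- The lower local entropy of `μ` at `x` along `{Fₙ}`:
`lim_{δ→0} liminf_n -(1/|Fₙ|) log μ(B_{Fₙ}(x,δ))` (the limit in `δ` being a supremum
by monotonicity). -/
noncomputable def localLowerEntropy (F : ℕ → Finset G) (μ : Measure X) (x : X) : ℝ≥0∞ :=
  ⨆ (δ : ℝ) (_ : 0 < δ),
    liminf (fun n =>
      ENNReal.ofReal (-(Real.log ((μ (bowenBall (F n) x δ)).toReal)) / (F n).card)) atTop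

end LocalDefs


section Maximal

set_option linter.unusedSectionVars false

variable {G : Type*} [Group G] [DecidableEq G] {X : Type*} [MeasurableSpace X] [MulAction G X]

/-- The set `⋃_{k<n} Fₖ⁻¹ Fₙ`. -/
def temperSet (F : ℕ → Finset G) (n : ℕ) : Finset G :=
  (Finset.range n).biUnion fun k => (F k)⁻¹ * F n

/-- The weight indicator of B_m over |F_m|. -/
noncomputable def wgt (F : ℕ → Finset G) (B : ℕ → Set X) (m : ℕ) : X → ℝ≥0∞ :=
  (B m).indicator (fun _ => ((F m).card : ℝ≥0∞)⁻¹)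

noncomputable def psiFn (F : ℕ → Finset G) (N : ℕ) (B : ℕ → Set X) (x : X) : ℝ≥0∞ :=
  ∑ m ∈ Finset.range N, ∑ a ∈ F m, wgt F B m (a⁻¹ • x)

noncomputable def thetaFn (F : ℕ → Finset G) (N : ℕ) (B : ℕ → Set X) (x : X) : ℝ≥0∞ :=
  ∑ m ∈ Finset.range N, ∑ u ∈ temperSet F m, wgt F B m (u⁻¹ • x)

lemma wgt_measurable (F : ℕ → Finset G) (B : ℕ → Set X) (hB : ∀ m, MeasurableSet (B m)) (m : ℕ) :
    Measurable (wgt F B m) := measurable_const.indicator (hB m)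

lemma psiFn_measurable (hs : ∀ g : G, Measurable (fun x : X => g • x))
    (F : ℕ → Finset G) (N : ℕ) (B : ℕ → Set X)
    (hB : ∀ m, MeasurableSet (B m)) : Measurable (psiFn F N B) := by
  unfold psiFn
  refine Finset.measurable_fun_sum _ fun m _ => Finset.measurable_fun_sum _ fun a _ => ?_
  exact (wgt_measurable F B hB m).comp (hs _)

lemma select_exists (hs : ∀ g : G, Measurable (fun x : X => g • x))
    (F : ℕ → Finset G) (hne : ∀ n, (F n).Nonempty) (B : ℕ → Set X)
    (hB : ∀ m, MeasurableSet (B m)) (N : ℕ) :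
    ∀ j ≤ N, ∃ B' : ℕ → Set X, (∀ m, MeasurableSet (B' m)) ∧ (∀ m, B' m ⊆ B m) ∧
      (∀ m < N - j, B' m = ∅) ∧ (∀ x, psiFn F N B' x ≤ 2) ∧
      ∀ m, N - j ≤ m → m < N → ∀ x ∈ B m \ B' m, 1 ≤ thetaFn F N B' x := by
  intro j
  induction j with
  | zero =>
    intro _
    refine ⟨fun _ => ∅, by simp, by simp, by simp, ?_, ?_⟩
    · intro x; simp [psiFn, wgt]
    · intro m h1 h2; omega
  | succ j ih =>
    intro hj
    obtain ⟨B', hm, hsub, hemp, hpsi, hth⟩ := ih (by omega)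
    set n := N - (j + 1) with hn
    have hnN : n < N := by omega
    set D : Set X := {x | x ∈ B n ∧ ∀ a ∈ F n, psiFn F N B' (a • x) < 1} with hD
    have hDm : MeasurableSet D := by
      have : D = B n ∩ ⋂ a ∈ F n, {x | psiFn F N B' (a • x) < 1} := by
        ext x; simp [hD]
      rw [this]
      refine (hB n).inter (Finset.measurableSet_biInter _ fun a _ => ?_)
      exact measurableSet_lt ((psiFn_measurable hs F N B' hm).comp (hs a)) measurable_const
    have hB'n : B' n = ∅ := hemp n (by omega)
    set B'' : ℕ → Set X := Function.update B' n D with hB''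
    have hBn : B'' n = D := by simp [hB'']
    have hBo : ∀ m, m ≠ n → B'' m = B' m := fun m h => by simp [hB'', h]
    have hwn : wgt F B' n = 0 := by simp [wgt, hB'n]; rfl
    have hwo : ∀ m, m ≠ n → wgt F B'' m = wgt F B' m := fun m h => by simp [wgt, hBo m h]
    have hwle : ∀ m x, wgt F B' m x ≤ wgt F B'' m x := by
      intro m x
      by_cases h : m = n
      · subst h; rw [hwn]; simp
      · rw [hwo m h]
    have hpsieq : ∀ x, psiFn F N B'' x = psiFn F N B' x + ∑ a ∈ F n, wgt F B'' n (a⁻¹ • x) := by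
      intro x
      unfold psiFn
      rw [← Finset.add_sum_erase _ _ (Finset.mem_range.2 hnN),
        ← Finset.add_sum_erase (Finset.range N) (fun m => ∑ a ∈ F m, wgt F B' m (a⁻¹ • x))
          (Finset.mem_range.2 hnN)]
      rw [hwn]
      simp only [Pi.zero_apply, Finset.sum_const_zero, zero_add]
      rw [add_comm]
      congr 1
      refine Finset.sum_congr rfl fun m hm => ?_
      rw [hwo m (Finset.ne_of_mem_erase hm)]
    have hcard : ((F n).card : ℝ≥0∞) ≠ 0 := by
      simpa using (hne n).ne_empty
    refine ⟨B'', ?_, ?_, ?_, ?_, ?_⟩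
    · intro m
      by_cases h : m = n
      · subst h; rw [hBn]; exact hDm
      · rw [hBo m h]; exact hm m
    · intro m
      by_cases h : m = n
      · subst h; rw [hBn]; intro x hx; exact hx.1
      · rw [hBo m h]; exact hsub m
    · intro m hmn
      rw [hBo m (by omega)]; exact hemp m (by omega)
    · intro x
      rw [hpsieq]
      by_cases hz : ∃ a ∈ F n, a⁻¹ • x ∈ D
      · obtain ⟨a, ha, hx⟩ := hz
        have h1 : psiFn F N B' x < 1 := by simpa using hx.2 a ha
        have h2 : ∑ a ∈ F n, wgt F B'' n (a⁻¹ • x) ≤ 1 := by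
          calc ∑ a ∈ F n, wgt F B'' n (a⁻¹ • x) ≤ ∑ a ∈ F n, ((F n).card : ℝ≥0∞)⁻¹ :=
                Finset.sum_le_sum fun a _ => Set.indicator_le_self _ _ _
            _ = 1 := by
                rw [Finset.sum_const, nsmul_eq_mul]
                exact ENNReal.mul_inv_cancel hcard (by simp)
        calc _ ≤ (1 : ℝ≥0∞) + 1 := add_le_add h1.le h2
          _ = 2 := by norm_num
      · push Not at hz
        have : ∑ a ∈ F n, wgt F B'' n (a⁻¹ • x) = 0 := by
          refine Finset.sum_eq_zero fun a ha => ?_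
          simp [wgt, hBn, hz a ha]
        rw [this, add_zero]; exact hpsi x
    · intro m hnm hmN x hx
      have hthle : thetaFn F N B' x ≤ thetaFn F N B'' x :=
        Finset.sum_le_sum fun m _ => Finset.sum_le_sum fun u _ => hwle m _
      by_cases h : m = n
      · subst h
        rw [hBn] at hx
        have : ∃ a ∈ F n, 1 ≤ psiFn F N B' (a • x) := by
          by_contra hcon
          push Not at hcon
          exact hx.2 ⟨hx.1, hcon⟩
        obtain ⟨a, ha, h1⟩ := this
        refine h1.trans (le_trans ?_ hthle)
        unfold psiFn thetaFn
        refine Finset.sum_le_sum fun l _ => ?_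
        by_cases hl : l ≤ n
        · have : wgt F B' l = 0 := by
            have : B' l = ∅ := hemp l (by omega)
            simp [wgt, this]; rfl
          rw [this]; simp
        · push Not at hl
          have hinj : Set.InjOn (fun b => a⁻¹ * b) (F l : Set G) := fun b _ c _ h => by simpa using h
          have e : ∑ b ∈ F l, wgt F B' l (b⁻¹ • a • x) =
              ∑ u ∈ (F l).image (fun b => a⁻¹ * b), wgt F B' l (u⁻¹ • x) := by
            rw [Finset.sum_image hinj]
            refine Finset.sum_congr rfl fun b _ => ?_
            simp [mul_smul]
          rw [e]
          refine Finset.sum_le_sum_of_subset ?_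
          intro u hu
          obtain ⟨b, hb, rfl⟩ := Finset.mem_image.1 hu
          refine Finset.mem_biUnion.2 ⟨n, Finset.mem_range.2 hl, ?_⟩
          exact Finset.mul_mem_mul (Finset.inv_mem_inv ha) hb
      · rw [hBo m h] at hx
        exact (hth m (by omega) hmN x hx).trans hthle

lemma lintegral_smul_eq {ν : Measure X} (hmp : ∀ g : G, MeasurePreserving (fun x : X => g • x) ν ν)
    (g : G) (f : X → ℝ≥0∞) (hf : Measurable f) : ∫⁻ x, f (g • x) ∂ν = ∫⁻ x, f x ∂ν :=
  (hmp g).lintegral_comp hf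

lemma maximal_aux {ν : Measure X} (hmp : ∀ g : G, MeasurePreserving (fun x : X => g • x) ν ν)
    (F : ℕ → Finset G) (hne : ∀ n, (F n).Nonempty) (C : ℝ≥0∞)
    (hC : ∀ n, ((temperSet F n).card : ℝ≥0∞) ≤ C * (F n).card)
    (B : ℕ → Set X) (hB : ∀ m, MeasurableSet (B m)) (hdis : Pairwise (Function.onFun Disjoint B))
    (f : X → ℝ≥0∞) (hf : Measurable f) (t : ℝ≥0∞)
    (hBf : ∀ n, ∀ x ∈ B n, t * (F n).card ≤ ∑ a ∈ F n, f (a • x)) (N : ℕ) :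
    t * ∑ n ∈ Finset.range N, ν (B n) ≤ (1 + C) * (2 * ∫⁻ x, f x ∂ν) := by
  have hs : ∀ g : G, Measurable (fun x : X => g • x) := fun g => (hmp g).measurable
  obtain ⟨B', hm, hsub, -, hpsi, hth⟩ := select_exists hs F hne B hB N N le_rfl
  have hc0 : ∀ n, ((F n).card : ℝ≥0∞) ≠ 0 := fun n => by simpa using (hne n).ne_empty
  have hct : ∀ n, ((F n).card : ℝ≥0∞) ≠ ⊤ := fun n => by simp
  have hwint : ∀ m, ∫⁻ x, wgt F B' m x ∂ν = ((F m).card : ℝ≥0∞)⁻¹ * ν (B' m) := fun m => by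
    unfold wgt; rw [lintegral_indicator_const (hm m)]
  have hwm := wgt_measurable F B' hm
  have hwu : ∀ m (u : G), Measurable fun x => wgt F B' m (u • x) := fun m u => (hwm m).comp (hs u)
  have hwf : ∀ m (u : G), Measurable fun x => wgt F B' m (u • x) * f x :=
    fun m u => (hwu m u).mul hf
  set S := ∑ n ∈ Finset.range N, ν (B' n) with hS
  -- the discarded part
  have hdisc : ∑ n ∈ Finset.range N, ν (B n \ B' n) ≤ C * S := by
    have h1 : ∑ n ∈ Finset.range N, ν (B n \ B' n) = ν (⋃ n ∈ Finset.range N, B n \ B' n) := by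
      rw [measure_biUnion_finset]
      · intro i _ j _ hij
        exact (hdis hij).mono sdiff_subset sdiff_subset
      · intro n _; exact (hB n).diff (hm n)
    rw [h1]
    have h2 : ν (⋃ n ∈ Finset.range N, B n \ B' n) ≤ ∫⁻ x, thetaFn F N B' x ∂ν := by
      have hthm : Measurable (thetaFn F N B') := by
        unfold thetaFn
        exact Finset.measurable_fun_sum _ fun m _ => Finset.measurable_fun_sum _ fun a _ =>
          hwu m _
      have := mul_meas_ge_le_lintegral (μ := ν) hthm 1
      rw [one_mul] at this
      refine le_trans (measure_mono ?_) this
      intro x hx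
      simp only [mem_iUnion, Finset.mem_range] at hx
      obtain ⟨n, hn, hx⟩ := hx
      exact hth n (by omega) hn x hx
    refine h2.trans ?_
    unfold thetaFn
    rw [lintegral_finsetSum _ (fun m _ => Finset.measurable_fun_sum _ fun a _ =>
          hwu m _), hS, Finset.mul_sum]
    refine Finset.sum_le_sum fun m _ => ?_
    rw [lintegral_finsetSum _ (fun a _ => hwu m _)]
    simp_rw [lintegral_smul_eq hmp _ _ (hwm m), hwint]
    rw [Finset.sum_const, nsmul_eq_mul, ← mul_assoc]
    gcongr
    calc _ ≤ C * (F m).card * ((F m).card : ℝ≥0∞)⁻¹ := by gcongr; exact hC m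
      _ = C := by rw [mul_assoc, ENNReal.mul_inv_cancel (hc0 m) (hct m), mul_one]
  have hsum : ∑ n ∈ Finset.range N, ν (B n) ≤ (1 + C) * S := by
    rw [add_mul, one_mul]
    refine le_trans ?_ (add_le_add (le_refl S) hdisc)
    rw [hS, ← Finset.sum_add_distrib]
    refine Finset.sum_le_sum fun n _ => ?_
    calc ν (B n) ≤ ν (B' n ∪ (B n \ B' n)) := measure_mono (by intro x hx; by_cases x ∈ B' n <;> simp_all)
      _ ≤ _ := measure_union_le _ _
  have hmain : t * S ≤ 2 * ∫⁻ x, f x ∂ν := by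
    have : t * S ≤ ∫⁻ x, psiFn F N B' x * f x ∂ν := by
      have e : ∀ x, psiFn F N B' x * f x =
          ∑ m ∈ Finset.range N, ∑ a ∈ F m, wgt F B' m (a⁻¹ • x) * f x := by
        intro x; unfold psiFn; simp_rw [Finset.sum_mul]
      simp_rw [e]
      rw [lintegral_finsetSum _ (fun m _ => Finset.measurable_fun_sum _ fun a _ =>
          hwf m _), hS, Finset.mul_sum]
      refine Finset.sum_le_sum fun m _ => ?_
      rw [lintegral_finsetSum _ (fun a _ => hwf m _)]
      have e2 : ∀ a ∈ F m, ∫⁻ x, wgt F B' m (a⁻¹ • x) * f x ∂ν =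
          ∫⁻ x, wgt F B' m x * f (a • x) ∂ν := by
        intro a _
        rw [← lintegral_smul_eq hmp a _ (hwf m _)]
        simp
      have hwf2 : ∀ a : G, Measurable fun x => wgt F B' m x * f (a • x) :=
        fun a => (hwm m).mul (hf.comp (hs a))
      rw [Finset.sum_congr rfl e2, ← lintegral_finsetSum _ (fun a _ => hwf2 a)]
      have e3 : t * ν (B' m) = ∫⁻ x, (B' m).indicator (fun _ => t) x ∂ν := by
        rw [lintegral_indicator_const (hm m)]
      rw [e3]
      refine lintegral_mono fun x => ?_
      by_cases hx : x ∈ B' m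
      · simp only [wgt, indicator_of_mem hx]
        rw [← Finset.mul_sum]
        calc t = ((F m).card : ℝ≥0∞)⁻¹ * (t * (F m).card) := by
              rw [mul_comm t, ← mul_assoc, ENNReal.inv_mul_cancel (hc0 m) (hct m), one_mul]
          _ ≤ _ := by gcongr; exact hBf m x (hsub m hx)
      · simp [indicator_of_notMem hx]
    refine this.trans ?_
    rw [← lintegral_const_mul _ hf]
    exact lintegral_mono fun x => by gcongr; exact hpsi x
  calc t * ∑ n ∈ Finset.range N, ν (B n) ≤ t * ((1 + C) * S) := by gcongr
    _ = (1 + C) * (t * S) := by ring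
    _ ≤ _ := by gcongr

/-- Weak type maximal inequality along a tempered sequence. -/
lemma maximal_ineq {ν : Measure X} (hmp : ∀ g : G, MeasurePreserving (fun x : X => g • x) ν ν)
    (F : ℕ → Finset G) (hne : ∀ n, (F n).Nonempty) (C : ℝ≥0∞)
    (hC : ∀ n, ((temperSet F n).card : ℝ≥0∞) ≤ C * (F n).card)
    (f : X → ℝ≥0∞) (hf : Measurable f) (t : ℝ≥0∞) :
    t * ν {x | ∃ n, t * (F n).card ≤ ∑ a ∈ F n, f (a • x)} ≤ (1 + C) * (2 * ∫⁻ x, f x ∂ν) := by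
  have hs : ∀ g : G, Measurable (fun x : X => g • x) := fun g => (hmp g).measurable
  set A : ℕ → Set X := fun n => {x | t * (F n).card ≤ ∑ a ∈ F n, f (a • x)} with hA
  have hAm : ∀ n, MeasurableSet (A n) := fun n =>
    measurableSet_le measurable_const (Finset.measurable_fun_sum _ fun a _ => hf.comp (hs a))
  have hBm : ∀ n, MeasurableSet (disjointed A n) := fun n => MeasurableSet.disjointed hAm n
  have h1 := maximal_aux hmp F hne C hC (disjointed A) hBm (disjoint_disjointed A) f hf t
    (fun n x hx => disjointed_subset A n hx)
  have e : {x | ∃ n, t * (F n).card ≤ ∑ a ∈ F n, f (a • x)} = ⋃ n, disjointed A n := by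
    rw [iUnion_disjointed]; ext x; simp [hA]
  rw [e, measure_iUnion (disjoint_disjointed A) hBm, ENNReal.tsum_eq_iSup_nat, ENNReal.mul_iSup]
  exact iSup_le h1

end Maximal

section ErgodicThm

set_option linter.unusedSectionVars false

variable {G : Type*} [Group G] [DecidableEq G] {X : Type*} [MeasurableSpace X] [MulAction G X]

/-- Ergodic average. -/
noncomputable def avgF (F : ℕ → Finset G) (n : ℕ) (φ : X → ℝ) (x : X) : ℝ :=
  (∑ a ∈ F n, φ (a • x)) / (F n).card

lemma integral_smul_eq' {ν : Measure X}
    (hmp : ∀ g : G, MeasurePreserving (fun x : X => g • x) ν ν)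
    (g : G) (f : X → ℝ) (hf : AEStronglyMeasurable f ν) :
    ∫ x, f (g • x) ∂ν = ∫ x, f x ∂ν := by
  have hmap : Measure.map (fun x => g • x) ν = ν := (hmp g).map_eq
  have := integral_map (μ := ν) (hmp g).measurable.aemeasurable (f := f) (by rwa [hmap])
  rw [hmap] at this
  exact this.symm

lemma avg_cob (F : ℕ → Finset G) (hF : IsFolnerSeq F) (φ : X → ℝ) (K : ℝ) (hK : ∀ x, |φ x| ≤ K)
    (h : G) (x : X) : Tendsto (fun n => avgF F n (fun x => φ x - φ (h • x)) x) atTop (𝓝 0) := by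
  have h1 := (hF.2 h).mul_const K
  rw [zero_mul] at h1
  refine squeeze_zero_norm (fun n => ?_) h1
  have hc : (0 : ℝ) < (F n).card := by exact_mod_cast (hF.1 n).card_pos
  have e1 : ∑ a ∈ F n, φ (h • a • x) = ∑ b ∈ (F n).image (h * ·), φ (b • x) := by
    rw [Finset.sum_image (fun a _ b _ hab => by simpa using hab)]
    simp [mul_smul]
  have hb : ∀ s : Finset G, |∑ b ∈ s, φ (b • x)| ≤ s.card * K := fun s => by
    refine (Finset.abs_sum_le_sum_abs _ _).trans ?_
    rw [← nsmul_eq_mul]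
    exact Finset.sum_le_card_nsmul _ _ _ fun b _ => hK _
  unfold avgF
  rw [Finset.sum_sub_distrib, e1, ← Finset.sum_sdiff_sub_sum_sdiff, Real.norm_eq_abs, abs_div,
    abs_of_pos hc, div_mul_eq_mul_div]
  gcongr
  refine (abs_sub _ _).trans ?_
  refine (add_le_add (hb _) (hb _)).trans (le_of_eq ?_)
  rw [← add_mul]
  congr 1
  rw [symmDiff_def, Finset.sup_eq_union, Finset.card_union_of_disjoint disjoint_sdiff_sdiff]
  push_cast; rfl

lemma inv_const {ν : Measure X} [IsProbabilityMeasure ν] (herg : ErgodicMeasure G ν) (u : X → ℝ)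
    (hu : Measurable u) (h : ∀ g : G, (fun x => u (g • x)) =ᵐ[ν] u) :
    ∃ c : ℝ, u =ᵐ[ν] fun _ => c := by
  refine Filter.exists_eventuallyEq_const_of_forall_separating MeasurableSet ?_
  intro U hU
  have := herg (u ⁻¹' U) (hu hU) ?_
  · rcases this with h0 | h1
    · right
      rw [measure_eq_zero_iff_ae_notMem] at h0
      exact h0
    · left
      have := (prob_compl_eq_zero_iff (hu hU)).2 h1
      rw [measure_eq_zero_iff_ae_notMem] at this
      filter_upwards [this] with x hx
      simpa using hx
  · intro g
    rw [measure_symmDiff_eq_zero_iff]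
    filter_upwards [h g] with x hx
    have hx' : u (g • x) = u x := hx
    have : (u x ∈ U) = (u (g • x) ∈ U) := by rw [hx']
    exact this

lemma exists_cob_approx {ν : Measure X} [IsProbabilityMeasure ν]
    (hmp : ∀ g : G, MeasurePreserving (fun x : X => g • x) ν ν)
    (herg : ErgodicMeasure G ν) (F : ℕ → Finset G) (hF : IsFolnerSeq F)
    (f : X → ℝ) (hf : Measurable f) (K : ℝ) (hK : ∀ x, |f x| ≤ K) (η : ℝ) (hη : 0 < η) :
    ∃ ψ : X → ℝ, Measurable ψ ∧ (∀ x, Tendsto (fun n => avgF F n ψ x) atTop (𝓝 0)) ∧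
      ∫⁻ x, ENNReal.ofReal |f x - ∫ y, f y ∂ν - ψ x| ∂ν ≤ ENNReal.ofReal η := by
  classical
  have hs : ∀ g : G, Measurable (fun x : X => g • x) := fun g => (hmp g).measurable
  set cob : Set (Lp ℝ 2 ν) := {v | ∃ A : Set X, MeasurableSet A ∧ ∃ h : G,
    v =ᵐ[ν] fun x => A.indicator (fun _ => (1 : ℝ)) x - A.indicator (fun _ => (1 : ℝ)) (h • x)}
    with hcob
  set V : Submodule ℝ (Lp ℝ 2 ν) := Submodule.span ℝ cob with hV
  have hgood : ∀ v ∈ V, ∃ ψ : X → ℝ, Measurable ψ ∧ v =ᵐ[ν] ψ ∧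
      ∀ x, Tendsto (fun n => avgF F n ψ x) atTop (𝓝 0) := by
    intro v hv
    induction hv using Submodule.span_induction with
    | mem v hv =>
      obtain ⟨A, hA, h, e⟩ := hv
      have hm : Measurable (A.indicator (fun _ => (1 : ℝ))) := measurable_const.indicator hA
      refine ⟨_, hm.sub (hm.comp (hs h)), e, fun x => ?_⟩
      refine avg_cob F hF _ 1 (fun x => ?_) h x
      by_cases hx : x ∈ A <;> simp [hx]
    | zero =>
      refine ⟨0, measurable_zero, Lp.coeFn_zero _ _ _, fun x => ?_⟩
      simp [avgF]
    | add v w _ _ hv hw =>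
      obtain ⟨ψ, h1, h2, h3⟩ := hv
      obtain ⟨χ, k1, k2, k3⟩ := hw
      refine ⟨ψ + χ, h1.add k1, (Lp.coeFn_add v w).trans (h2.add k2), fun x => ?_⟩
      have := (h3 x).add (k3 x)
      rw [add_zero] at this
      refine this.congr fun n => ?_
      simp [avgF, Finset.sum_add_distrib, add_div]
    | smul c v _ hv =>
      obtain ⟨ψ, h1, h2, h3⟩ := hv
      refine ⟨c • ψ, h1.const_smul c, (Lp.coeFn_smul c v).trans (h2.const_smul c), fun x => ?_⟩
      have := (h3 x).const_mul c
      rw [mul_zero] at this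
      refine this.congr fun n => ?_
      simp only [avgF, Pi.smul_apply, smul_eq_mul, ← Finset.mul_sum]
      ring
  set c0 := ∫ y, f y ∂ν with hc0
  have hfint : Integrable f ν := Integrable.of_bound hf.aestronglyMeasurable K
    (Eventually.of_forall hK)
  have hfm : MemLp (fun x => f x - c0) 2 ν := by
    refine MemLp.of_bound (hf.sub measurable_const).aestronglyMeasurable (K + |c0|) ?_
    refine Eventually.of_forall fun x => ?_
    refine (abs_sub _ _).trans ?_
    have := hK x
    gcongr
  set f0 : Lp ℝ 2 ν := hfm.toLp with hf0
  have hmem : f0 ∈ V.topologicalClosure := by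
    rw [← Submodule.orthogonal_orthogonal_eq_closure]
    rw [Submodule.mem_orthogonal]
    intro u hu
    have hum : StronglyMeasurable u := Lp.stronglyMeasurable u
    have huint : Integrable u ν := (Lp.memLp u).integrable (by norm_num)
    have hinv : ∀ g : G, (fun x => u (g • x)) =ᵐ[ν] u := by
      intro g
      have hug : Integrable (fun x => u (g • x)) ν := (hmp g).integrable_comp_of_integrable huint
      refine Integrable.ae_eq_of_forall_setIntegral_eq _ _ hug huint ?_
      intro A hA _
      -- use the coboundary of the indicator by `g⁻¹`
      have hm : Measurable (A.indicator (fun _ => (1 : ℝ))) := measurable_const.indicator hA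
      have hbd : ∀ x, |A.indicator (fun _ => (1 : ℝ)) x| ≤ 1 := fun x => by
        by_cases hx : x ∈ A <;> simp [hx]
      have hmem : MemLp (fun x => A.indicator (fun _ => (1 : ℝ)) x -
          A.indicator (fun _ => (1 : ℝ)) (g⁻¹ • x)) 2 ν := by
        refine MemLp.of_bound (hm.sub (hm.comp (hs _))).aestronglyMeasurable 2 ?_
        refine Eventually.of_forall fun x => ?_
        refine (abs_sub _ _).trans ?_
        linarith [hbd x, hbd (g⁻¹ • x)]
      have hv : hmem.toLp ∈ V := Submodule.subset_span ⟨A, hA, g⁻¹, hmem.coeFn_toLp⟩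
      have h0 := (Submodule.mem_orthogonal _ _).1 hu _ hv
      rw [L2.inner_def] at h0
      have h1 : ∫ x, u x * A.indicator (fun _ => (1 : ℝ)) x -
          u x * A.indicator (fun _ => (1 : ℝ)) (g⁻¹ • x) ∂ν = 0 := by
        rw [← h0]
        refine integral_congr_ae ?_
        filter_upwards [hmem.coeFn_toLp] with x hx
        rw [hx]; simp; ring
      have i1 : Integrable (fun x => u x * A.indicator (fun _ => (1 : ℝ)) x) ν :=
        huint.mul_bdd (c := 1) hm.aestronglyMeasurable (Eventually.of_forall hbd)
      have i2 : Integrable (fun x => u x * A.indicator (fun _ => (1 : ℝ)) (g⁻¹ • x)) ν :=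
        huint.mul_bdd (c := 1) (hm.comp (hs _)).aestronglyMeasurable
          (Eventually.of_forall fun x => hbd _)
      rw [integral_sub i1 i2, sub_eq_zero] at h1
      have h2 : ∫ x, u x * A.indicator (fun _ => (1 : ℝ)) (g⁻¹ • x) ∂ν =
          ∫ x, u (g • x) * A.indicator (fun _ => (1 : ℝ)) x ∂ν := by
        have h3 := integral_smul_eq' hmp g
          (fun x => u x * A.indicator (fun _ => (1 : ℝ)) (g⁻¹ • x)) i2.aestronglyMeasurable
        rw [← h3]
        simp
      rw [h2] at h1
      rw [← integral_indicator hA, ← integral_indicator hA]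
      have e : ∀ w : X → ℝ, A.indicator w = fun x => w x * A.indicator (fun _ => (1 : ℝ)) x := by
        intro w; ext x; by_cases hx : x ∈ A <;> simp [hx]
      rw [e (fun x => u (g • x)), e u]
      exact h1.symm
    obtain ⟨c, hc⟩ := inv_const herg u hum.measurable hinv
    rw [L2.inner_def]
    have : ∫ x, inner ℝ (u x) (f0 x) ∂ν = ∫ x, (f x - c0) * c ∂ν := by
      refine integral_congr_ae ?_
      filter_upwards [hc, hfm.coeFn_toLp] with x h1 h2
      rw [h1, h2]; simp
    rw [this, integral_mul_const, integral_sub hfint (integrable_const _)]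
    simp [hc0]
  have hcl : f0 ∈ closure (V : Set (Lp ℝ 2 ν)) := hmem
  obtain ⟨v, hv, hd⟩ := Metric.mem_closure_iff.1 hcl η hη
  obtain ⟨ψ, hψ, hvψ, hav⟩ := hgood v hv
  refine ⟨ψ, hψ, hav, ?_⟩
  have e1 : ∫⁻ x, ENNReal.ofReal |f x - c0 - ψ x| ∂ν = eLpNorm (⇑(f0 - v)) 1 ν := by
    rw [eLpNorm_one_eq_lintegral_enorm]
    refine lintegral_congr_ae ?_
    filter_upwards [Lp.coeFn_sub f0 v, hvψ, hfm.coeFn_toLp] with x h1 h2 h3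
    rw [h1, Pi.sub_apply, h2, h3, Real.enorm_eq_ofReal_abs]
  rw [e1]
  refine (eLpNorm_le_eLpNorm_of_exponent_le (by norm_num : (1 : ℝ≥0∞) ≤ 2)
    (Lp.aestronglyMeasurable _)).trans ?_
  rw [← ENNReal.ofReal_toReal (Lp.eLpNorm_ne_top (f0 - v))]
  apply ENNReal.ofReal_le_ofReal
  rw [← Lp.norm_def, ← dist_eq_norm]
  exact hd.le

/-- Pointwise ergodic theorem for bounded functions along tempered Følner sequences. -/
lemma pointwise_ergodic {ν : Measure X} [IsProbabilityMeasure ν]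
    (hmp : ∀ g : G, MeasurePreserving (fun x : X => g • x) ν ν)
    (herg : ErgodicMeasure G ν) (F : ℕ → Finset G) (hF : IsFolnerSeq F) (hT : IsTemperedSeq F)
    (f : X → ℝ) (hf : Measurable f) (K : ℝ) (hK : ∀ x, |f x| ≤ K) :
    ∀ᵐ x ∂ν, Tendsto (fun n => avgF F n f x) atTop (𝓝 (∫ y, f y ∂ν)) := by
  have hs : ∀ g : G, Measurable (fun x : X => g • x) := fun g => (hmp g).measurable
  obtain ⟨C0, hC0⟩ := hT
  set C : ℝ≥0∞ := ENNReal.ofReal C0 with hC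
  have hCt : ∀ n, ((temperSet F n).card : ℝ≥0∞) ≤ C * (F n).card := by
    intro n
    have h1 : ((temperSet F n).card : ℝ) ≤ C0 * (F n).card := hC0 n
    have := ENNReal.ofReal_le_ofReal h1
    rwa [ENNReal.ofReal_mul' (by positivity), ENNReal.ofReal_natCast, ENNReal.ofReal_natCast] at this
  set c0 := ∫ y, f y ∂ν with hc0
  have key : ∀ j : ℕ, ∀ᵐ x ∂ν, ∀ᶠ n in atTop, |avgF F n f x - c0| < 2 / ((j : ℝ) + 1) := by
    intro j
    set t : ℝ := 1 / ((j : ℝ) + 1) with ht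
    have htpos : 0 < t := by positivity
    have ht2 : 2 / ((j : ℝ) + 1) = t + t := by rw [ht]; ring
    rw [ht2]
    rw [ae_iff]
    have bound : ∀ η : ℝ, 0 < η →
        ENNReal.ofReal t * ν {x | ¬ ∀ᶠ n in atTop, |avgF F n f x - c0| < t + t} ≤
          (1 + C) * (2 * ENNReal.ofReal η) := by
      intro η hη
      obtain ⟨ψ, hψ, hav, hintg⟩ := exists_cob_approx hmp herg F hF f hf K hK η hη
      have hr : Measurable fun x => ENNReal.ofReal |f x - c0 - ψ x| :=
        (((hf.sub measurable_const).sub hψ).abs).ennreal_ofReal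
      have hmax := maximal_ineq hmp F hF.1 C hCt _ hr (ENNReal.ofReal t)
      refine le_trans ?_ (hmax.trans (by gcongr))
      gcongr ENNReal.ofReal t * ?_
      refine measure_mono ?_
      intro x hx
      by_contra hcon
      simp only [mem_ofPred_eq, not_exists, not_le] at hcon
      apply hx
      have h1 := hav x
      have h2 := (Metric.tendsto_nhds.1 h1) t htpos
      filter_upwards [h2] with n hn
      have hcp : (0 : ℝ) < (F n).card := by exact_mod_cast (hF.1 n).card_pos
      have h3 := hcon n
      rw [← ENNReal.ofReal_sum_of_nonneg (fun _ _ => abs_nonneg _), ← ENNReal.ofReal_natCast,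
        ← ENNReal.ofReal_mul htpos.le, ENNReal.ofReal_lt_ofReal_iff (by positivity)] at h3
      have h4 : avgF F n f x - c0 =
          avgF F n ψ x + (∑ a ∈ F n, (f (a • x) - c0 - ψ (a • x))) / (F n).card := by
        unfold avgF
        rw [Finset.sum_sub_distrib, Finset.sum_sub_distrib, Finset.sum_const, nsmul_eq_mul]
        field_simp
        ring
      rw [h4]
      have h5 : |avgF F n ψ x| < t := by simpa [Real.dist_eq] using hn
      refine (abs_add_le _ _).trans_lt (add_lt_add h5 ?_)
      rw [abs_div, abs_of_pos hcp, div_lt_iff₀ hcp]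
      exact (Finset.abs_sum_le_sum_abs _ _).trans_lt h3
    have hz : ENNReal.ofReal t * ν {x | ¬ ∀ᶠ n in atTop, |avgF F n f x - c0| < t + t} ≤ 0 := by
      have hlim : Tendsto (fun η : ℝ => (1 + C) * (2 * ENNReal.ofReal η)) (𝓝[>] 0)
          (𝓝 ((1 + C) * (2 * ENNReal.ofReal 0))) := by
        refine ENNReal.Tendsto.const_mul (ENNReal.Tendsto.const_mul ?_ (Or.inr (by simp)))
          (Or.inr (by simp [hC]))
        exact (ENNReal.continuous_ofReal.tendsto 0).mono_left nhdsWithin_le_nhds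
      have hl : (1 + C) * (2 * ENNReal.ofReal 0) = 0 := by simp
      rw [hl] at hlim
      refine ge_of_tendsto hlim ?_
      filter_upwards [self_mem_nhdsWithin] with η hη using bound η hη
    have hz' := le_antisymm hz zero_le
    rcases mul_eq_zero.1 hz' with h | h
    · simp at h; linarith
    · exact h
  rw [← ae_all_iff] at key
  filter_upwards [key] with x hx
  rw [Metric.tendsto_nhds]
  intro ε hε
  obtain ⟨j, hj⟩ := exists_nat_one_div_lt (half_pos hε)
  filter_upwards [hx j] with n hn
  rw [Real.dist_eq]
  refine hn.trans ?_
  have : 2 / ((j : ℝ) + 1) = 2 * (1 / ((j : ℝ) + 1)) := by ring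
  linarith

end ErgodicThm

section WeakLimit

set_option linter.unusedSectionVars false

variable {X : Type*} [MeasurableSpace X]

lemma exists_weak_limit {ν : Measure X} [IsProbabilityMeasure ν] (f : ℕ → X → ℝ)
    (hf : ∀ m, Measurable (f m)) (K : ℝ) (hK : ∀ m x, 0 ≤ f m x ∧ f m x ≤ K) (U : Ultrafilter ℕ) :
    ∃ J : X → ℝ, Measurable J ∧ (∀ x, 0 ≤ J x ∧ J x ≤ K) ∧
      ∀ φ : X → ℝ, Measurable φ → (∃ L : ℝ, ∀ x, |φ x| ≤ L) →
        Tendsto (fun m => ∫ x, f m x * φ x ∂ν) U (𝓝 (∫ x, J x * φ x ∂ν)) := by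
  have hne : Nonempty X := by
    by_contra h
    rw [not_nonempty_iff] at h
    have := measure_univ (μ := ν)
    rw [Set.eq_empty_of_isEmpty (univ : Set X)] at this
    simp at this
  have hK0 : 0 ≤ K := (hK 0 hne.some).1.trans (hK 0 hne.some).2
  have hb : ∀ m x, |f m x| ≤ K := fun m x => by rw [abs_of_nonneg (hK m x).1]; exact (hK m x).2
  have hmem : ∀ m, MemLp (f m) 2 ν := fun m =>
    MemLp.of_bound (hf m).aestronglyMeasurable K (Eventually.of_forall (hb m))
  set w : ℕ → WeakDual ℝ (Lp ℝ 2 ν) := fun m =>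
    StrongDual.toWeakDual (InnerProductSpace.toDual ℝ (Lp ℝ 2 ν) (hmem m).toLp) with hw
  have hcomp := WeakDual.isCompact_closedBall (𝕜 := ℝ) (E := Lp ℝ 2 ν) 0 K
  have hin : ∀ m, w m ∈ WeakDual.toStrongDual ⁻¹' Metric.closedBall (0 : StrongDual ℝ (Lp ℝ 2 ν)) K := by
    intro m
    simp only [hw, mem_preimage, Metric.mem_closedBall, dist_zero_right]
    have : ‖(hmem m).toLp‖ ≤ K := by
      have h1 := Lp.norm_le_of_ae_bound (μ := ν) (p := 2) (f := (hmem m).toLp) hK0 (by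
        filter_upwards [(hmem m).coeFn_toLp] with x hx
        rw [hx]; exact hb m x)
      have h2 : measureUnivNNReal ν = 1 := by simp [measureUnivNNReal]
      rw [h2] at h1
      simpa using h1
    refine le_trans (le_of_eq ?_) this
    exact (InnerProductSpace.toDual ℝ (Lp ℝ 2 ν)).norm_map _
  obtain ⟨ℓ, -, hℓ⟩ := hcomp.ultrafilter_le_nhds (U.map w)
    (by
      rw [Filter.le_principal_iff]
      exact Filter.mem_map.2 (Filter.univ_mem' hin))
  have hlim : ∀ v : Lp ℝ 2 ν, Tendsto (fun m => w m v) U (𝓝 (ℓ v)) := by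
    intro v
    exact ((WeakDual.eval_continuous v).tendsto ℓ).comp hℓ
  set J0 : Lp ℝ 2 ν := (InnerProductSpace.toDual ℝ (Lp ℝ 2 ν)).symm (WeakDual.toStrongDual ℓ) with hJ0
  have hJint : Integrable J0 ν := (Lp.memLp J0).integrable (by norm_num)
  have hJ0l : ∀ v, inner ℝ J0 v = ℓ v := by
    intro v
    rw [hJ0, InnerProductSpace.toDual_symm_apply]; rfl
  have hconv : ∀ φ : X → ℝ, Measurable φ → (∃ L : ℝ, ∀ x, |φ x| ≤ L) →
        Tendsto (fun m => ∫ x, f m x * φ x ∂ν) U (𝓝 (∫ x, J0 x * φ x ∂ν)) := by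
    rintro φ hφ ⟨L, hL⟩
    have hφm : MemLp φ 2 ν :=
      MemLp.of_bound hφ.aestronglyMeasurable L (Eventually.of_forall hL)
    have h1 := hlim hφm.toLp
    rw [← hJ0l, L2.inner_def] at h1
    have e1 : ∫ x, inner ℝ (J0 x) ((hφm.toLp φ : Lp ℝ 2 ν) x) ∂ν = ∫ x, J0 x * φ x ∂ν := by
      refine integral_congr_ae ?_
      filter_upwards [hφm.coeFn_toLp] with x hx
      rw [hx]; simp [mul_comm]
    rw [e1] at h1
    refine h1.congr fun m => ?_
    have : w m hφm.toLp = inner ℝ (hmem m).toLp hφm.toLp := by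
      simp only [hw]
      exact InnerProductSpace.toDual_apply_apply
    rw [this, L2.inner_def]
    refine integral_congr_ae ?_
    filter_upwards [hφm.coeFn_toLp, (hmem m).coeFn_toLp] with x hx hx2
    rw [hx, hx2]; simp [mul_comm]
  have hset : ∀ A, MeasurableSet A →
      Tendsto (fun m => ∫ x in A, f m x ∂ν) U (𝓝 (∫ x in A, J0 x ∂ν)) := by
    intro A hA
    have := hconv (A.indicator (fun _ => 1)) (measurable_const.indicator hA)
      ⟨1, fun x => by by_cases hx : x ∈ A <;> simp [hx]⟩
    have e : ∀ w : X → ℝ, ∫ x, w x * A.indicator (fun _ => (1 : ℝ)) x ∂ν = ∫ x in A, w x ∂ν := by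
      intro w
      rw [← integral_indicator hA]
      congr 1
      ext x; by_cases hx : x ∈ A <;> simp [hx]
    simpa only [e] using this
  have hfi : ∀ m, Integrable (f m) ν := fun m => (hmem m).integrable (by norm_num)
  have h0 : ∀ᵐ x ∂ν, 0 ≤ J0 x := by
    refine ae_nonneg_of_forall_setIntegral_nonneg hJint ?_
    intro A hA _
    exact ge_of_tendsto (hset A hA) (Eventually.of_forall fun m =>
      setIntegral_nonneg hA fun x _ => (hK m x).1)
  have h1 : ∀ᵐ x ∂ν, J0 x ≤ K := by
    refine ae_le_of_forall_setIntegral_le hJint (integrable_const K) ?_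
    intro A hA _
    exact le_of_tendsto (hset A hA) (Eventually.of_forall fun m =>
      setIntegral_mono (hfi m).integrableOn (integrable_const K).integrableOn fun x => (hK m x).2)
  refine ⟨fun x => max 0 (min K (J0 x)), ?_, ?_, ?_⟩
  · exact measurable_const.max (measurable_const.min (Lp.stronglyMeasurable J0).measurable)
  · intro x
    exact ⟨le_max_left _ _, max_le hK0 (min_le_left _ _)⟩
  · intro φ hφ hL
    have e : ∫ x, max 0 (min K (J0 x)) * φ x ∂ν = ∫ x, J0 x * φ x ∂ν := by
      refine integral_congr_ae ?_
      filter_upwards [h0, h1] with x hx0 hx1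
      rw [min_eq_right hx1, max_eq_right hx0]
    rw [e]
    exact hconv φ hφ hL

end WeakLimit

section Info

set_option linter.unusedSectionVars false

lemma integral_comp_fin {X γ : Type*} [MeasurableSpace X] [Fintype γ] [MeasurableSpace γ]
    [MeasurableSingletonClass γ] {ν : Measure X} [IsProbabilityMeasure ν] (T : X → γ)
    (hT : Measurable T) (φ : γ → ℝ) :
    Integrable (fun x => φ (T x)) ν ∧ ∫ x, φ (T x) ∂ν = ∑ t, ν.real {y | T y = t} * φ t := by
  have : IsProbabilityMeasure (ν.map T) := Measure.isProbabilityMeasure_map hT.aemeasurable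
  have h1 : Integrable φ (ν.map T) := Integrable.of_finite
  refine ⟨h1.comp_measurable hT, ?_⟩
  have h2 := integral_fintype h1
  rw [integral_map hT.aemeasurable h1.aestronglyMeasurable] at h2
  rw [h2]
  refine Finset.sum_congr rfl fun t _ => ?_
  rw [smul_eq_mul, measureReal_def, Measure.map_apply hT (measurableSet_singleton t)]
  rfl

lemma ae_fin_pos {X γ : Type*} [MeasurableSpace X] [Fintype γ] [MeasurableSpace γ]
    [MeasurableSingletonClass γ] {ν : Measure X} [IsProbabilityMeasure ν] (T : X → γ)
    (_hT : Measurable T) : ∀ᵐ x ∂ν, 0 < ν.real {y | T y = T x} := by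
  have h : ∀ t, ∀ᵐ x ∂ν, T x = t → 0 < ν.real {y | T y = t} := by
    intro t
    by_cases h0 : ν {y | T y = t} = 0
    · have : ∀ᵐ x ∂ν, ¬ (T x = t) := by
        rw [ae_iff]; simpa using h0
      filter_upwards [this] with x hx h
      exact absurd h hx
    · exact Eventually.of_forall fun x _ => ENNReal.toReal_pos h0 (measure_ne_top _ _)
  filter_upwards [ae_all_iff.2 h] with x hx
  exact hx _ rfl

lemma info_step {X γ ι : Type*} [MeasurableSpace X] [Fintype γ] [MeasurableSpace γ]
    [MeasurableSingletonClass γ] [Fintype ι] [MeasurableSpace ι] [MeasurableSingletonClass ι]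
    {ν : Measure X} [IsProbabilityMeasure ν] (T : X → γ)
    (hT : Measurable T) (β : X → ι) (hβ : Measurable β) (u : γ → ℝ) (hu : ∀ t, 0 ≤ u t)
    (r : ι → ℝ) (hr : ∀ i, 0 ≤ r i) :
    Integrable (fun x => u (T x) * r (β x) *
      (ν.real {y | T y = T x} / ν.real {y | T y = T x ∧ β y = β x})) ν ∧
    ∫ x, u (T x) * r (β x) *
      (ν.real {y | T y = T x} / ν.real {y | T y = T x ∧ β y = β x}) ∂ν
      ≤ (∑ i, r i) * ∫ x, u (T x) ∂ν := by
  have h1 := integral_comp_fin (ν := ν) (fun x => (T x, β x)) (hT.prodMk hβ)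
    (fun z => u z.1 * r z.2 * (ν.real {y | T y = z.1} / ν.real {y | T y = z.1 ∧ β y = z.2}))
  refine ⟨h1.1, ?_⟩
  have h2 := h1.2
  simp only at h2
  rw [h2, (integral_comp_fin (ν := ν) T hT u).2, Fintype.sum_prod_type, Finset.mul_sum]
  refine Finset.sum_le_sum fun t _ => ?_
  rw [Finset.sum_mul]
  refine Finset.sum_le_sum fun i _ => ?_
  simp only [Prod.mk.injEq]
  set a := ν.real {y | T y = t}
  set b := ν.real {y | T y = t ∧ β y = i}
  have ha : 0 ≤ a := measureReal_nonneg
  have hur : 0 ≤ u t * r i := mul_nonneg (hu t) (hr i)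
  by_cases hb : b = 0
  · rw [hb, zero_mul]
    exact mul_nonneg (hr i) (mul_nonneg ha (hu t))
  · apply le_of_eq
    field_simp

variable {G : Type*} [Group G] [DecidableEq G] {X : Type*} [MeasurableSpace X] [MulAction G X]
  {k : ℕ}

/-- the name of a point over a finite set -/
def nm (α : X → Fin k) (S : Finset G) (x : X) : ↥S → Fin k := fun g => α ((g : G) • x)

/-- measure of the cell of the join over `S` containing `x` -/
noncomputable def mm (ν : Measure X) (α : X → Fin k) (S : Finset G) (x : X) : ℝ :=
  ν.real {y | nm α S y = nm α S x}

/-- truncated conditional information along a list -/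
noncomputable def DK (ν : Measure X) (α : X → Fin k) (K : ℝ) : List G → G → X → ℝ
  | [], _, _ => 0
  | a :: l, g, x => if g = a then
      min K (Real.log (mm ν α l.toFinset x / mm ν α (a :: l).toFinset x)) else DK ν α K l g x

lemma nm_eq_iff {α : X → Fin k} {S : Finset G} {x y : X} :
    nm α S y = nm α S x ↔ ∀ g ∈ S, α (g • y) = α (g • x) := by
  rw [funext_iff]
  exact ⟨fun h g hg => h ⟨g, hg⟩, fun h g => h g.1 g.2⟩

lemma nm_mono {α : X → Fin k} {S S' : Finset G} (hS : S ⊆ S') {x y : X}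
    (h : nm α S' y = nm α S' x) : nm α S y = nm α S x :=
  nm_eq_iff.2 fun g hg => nm_eq_iff.1 h g (hS hg)

lemma nm_insert {α : X → Fin k} {S : Finset G} {a : G} {x y : X} :
    nm α (insert a S) y = nm α (insert a S) x ↔ nm α S y = nm α S x ∧ α (a • y) = α (a • x) := by
  simp only [nm_eq_iff, Finset.mem_insert, forall_eq_or_imp]
  tauto

variable {ν : Measure X} [IsProbabilityMeasure ν] {α : X → Fin k}



lemma measurable_nm (hmp : ∀ g : G, MeasurePreserving (fun x : X => g • x) ν ν)
    (hα : Measurable α) (S : Finset G) : Measurable (nm α S) :=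
  measurable_pi_lambda _ fun g => hα.comp (hmp g.1).measurable

lemma factor_nm (S : Finset G) (u : X → ℝ) (hc : ∀ x y, nm α S y = nm α S x → u y = u x) :
    ∃ u' : (↥S → Fin k) → ℝ, ((∀ x, 0 ≤ u x) → ∀ t, 0 ≤ u' t) ∧ ∀ x, u x = u' (nm α S x) := by
  classical
  refine ⟨fun t => if h : ∃ x, nm α S x = t then u h.choose else 0, ?_, ?_⟩
  · intro h0 t
    by_cases h : ∃ x, nm α S x = t
    · simp only [h, dite_true]; exact h0 _
    · simp only [h, dite_false]; exact le_rfl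
  · intro x
    have h : ∃ z, nm α S z = nm α S x := ⟨x, rfl⟩
    simp only [h, dite_true]
    exact (hc x h.choose h.choose_spec).symm

lemma meas_of_nm (hmp : ∀ g : G, MeasurePreserving (fun x : X => g • x) ν ν)
    (hα : Measurable α) (S : Finset G) (u : X → ℝ)
    (hc : ∀ x y, nm α S y = nm α S x → u y = u x) : Measurable u ∧ Integrable u ν := by
  obtain ⟨u', -, hu'⟩ := factor_nm S u hc
  have : u = fun x => u' (nm α S x) := funext hu'
  rw [this]
  exact ⟨(measurable_of_finite u').comp (measurable_nm hmp hα S),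
    (integral_comp_fin (ν := ν) (nm α S) (measurable_nm hmp hα S) u').1⟩

lemma mm_congr {S S' : Finset G} (hS : S ⊆ S') {x y : X} (h : nm α S' y = nm α S' x) :
    mm ν α S y = mm ν α S x := by
  unfold mm
  rw [nm_mono hS h]

lemma DK_congr (K : ℝ) (l : List G) (g : G) {x y : X}
    (h : nm α l.toFinset y = nm α l.toFinset x) : DK ν α K l g y = DK ν α K l g x := by
  induction l with
  | nil => rfl
  | cons a l ih =>
    have hsub : l.toFinset ⊆ (a :: l).toFinset := by
      intro b hb; simp at hb ⊢; exact Or.inr hb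
    simp only [DK]
    rw [mm_congr hsub h, mm_congr subset_rfl h, ih (nm_mono hsub h)]

lemma mm_mono {S S' : Finset G} (hS : S ⊆ S') (x : X) : mm ν α S' x ≤ mm ν α S x :=
  measureReal_mono (fun _ hy => nm_mono hS hy) (measure_ne_top _ _)

lemma DK_bound (K : ℝ) (hK : 0 ≤ K) (l : List G) (g : G) (x : X) :
    0 ≤ DK ν α K l g x ∧ DK ν α K l g x ≤ K := by
  induction l with
  | nil => exact ⟨le_rfl, hK⟩
  | cons a l ih =>
    simp only [DK]
    split_ifs
    · refine ⟨le_min hK ?_, min_le_left _ _⟩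
      have hsub : l.toFinset ⊆ (a :: l).toFinset := by
        intro b hb; simp at hb ⊢; exact Or.inr hb
      have h0 : 0 ≤ mm ν α (a :: l).toFinset x := measureReal_nonneg
      rcases h0.eq_or_lt with h | h
      · rw [← h]; simp
      · exact Real.log_nonneg ((one_le_div h).2 (mm_mono hsub x))
    · exact ih

lemma DK_not_mem (K : ℝ) (l : List G) (g : G) (hg : g ∉ l) (x : X) : DK ν α K l g x = 0 := by
  induction l with
  | nil => rfl
  | cons a l ih =>
    simp only [List.mem_cons, not_or] at hg
    simp only [DK, hg.1, if_false]
    exact ih hg.2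

lemma info_step_mm (hmp : ∀ g : G, MeasurePreserving (fun x : X => g • x) ν ν)
    (hα : Measurable α) (S : Finset G) (a : G) (u : X → ℝ)
    (hc : ∀ x y, nm α S y = nm α S x → u y = u x) (hu : ∀ x, 0 ≤ u x)
    (r : Fin k → ℝ) (hr : ∀ i, 0 ≤ r i) :
    Integrable (fun x => u x * r (α (a • x)) * (mm ν α S x / mm ν α (insert a S) x)) ν ∧
    ∫ x, u x * r (α (a • x)) * (mm ν α S x / mm ν α (insert a S) x) ∂ν
      ≤ (∑ i, r i) * ∫ x, u x ∂ν := by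
  obtain ⟨u', hu0, hu'⟩ := factor_nm S u hc
  have h := info_step (ν := ν) (nm α S) (measurable_nm hmp hα S) (fun x => α (a • x))
    (hα.comp (hmp a).measurable) u' (hu0 hu) r hr
  simp only [← hu'] at h
  unfold mm
  simp only [nm_insert]
  exact h

lemma mm_pos (hmp : ∀ g : G, MeasurePreserving (fun x : X => g • x) ν ν)
    (hα : Measurable α) (S : Finset G) : ∀ᵐ x ∂ν, 0 < mm ν α S x :=
  ae_fin_pos (nm α S) (measurable_nm hmp hα S)

lemma prod_DK (hmp : ∀ g : G, MeasurePreserving (fun x : X => g • x) ν ν)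
    (hα : Measurable α) (K : ℝ) (l : List G) (hl : l.Nodup) (A : Finset G)
    (hA : A ⊆ l.toFinset) (r : G → Fin k → ℝ) (hr : ∀ g i, 0 ≤ r g i) :
    ∫ x, ∏ g ∈ A, (r g (α (g • x)) * Real.exp (DK ν α K l g x)) ∂ν ≤ ∏ g ∈ A, ∑ i, r g i := by
  induction l generalizing A with
  | nil =>
    have : A = ∅ := by simpa using hA
    subst this
    simp
  | cons a l ih =>
    rw [List.nodup_cons] at hl
    have hsub : l.toFinset ⊆ (a :: l).toFinset := by
      intro b hb; simp at hb ⊢; exact Or.inr hb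
    have hins : (a :: l).toFinset = insert a l.toFinset := by simp
    have hne : ∀ g, g ≠ a → ∀ x, DK ν α K (a :: l) g x = DK ν α K l g x := by
      intro g hg x; simp [DK, hg]
    have hcongr : ∀ B : Finset G, B ⊆ l.toFinset → ∀ x,
        ∏ g ∈ B, (r g (α (g • x)) * Real.exp (DK ν α K (a :: l) g x)) =
        ∏ g ∈ B, (r g (α (g • x)) * Real.exp (DK ν α K l g x)) := by
      intro B hB x
      refine Finset.prod_congr rfl fun g hg => ?_
      rw [hne g]
      rintro rfl
      exact hl.1 (List.mem_toFinset.1 (hB hg))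
    by_cases haA : a ∈ A
    · set B := A.erase a with hBdef
      have hB : B ⊆ l.toFinset := by
        intro b hb
        have h1 := Finset.mem_erase.1 hb
        have h2 := hA h1.2
        rw [hins, Finset.mem_insert] at h2
        exact h2.resolve_left h1.1
      set u : X → ℝ := fun x => ∏ g ∈ B, (r g (α (g • x)) * Real.exp (DK ν α K l g x)) with hu
      have hu0 : ∀ x, 0 ≤ u x := fun x =>
        Finset.prod_nonneg fun g _ => mul_nonneg (hr _ _) (Real.exp_pos _).le
      have huc : ∀ x y, nm α l.toFinset y = nm α l.toFinset x → u y = u x := by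
        intro x y h
        refine Finset.prod_congr rfl fun g hg => ?_
        rw [DK_congr K l g h, nm_eq_iff.1 h g (hB hg)]
      obtain ⟨i1, i2⟩ := info_step_mm hmp hα l.toFinset a u huc hu0 (r a) (hr a)
      have hintg : Integrable (fun x => ∏ g ∈ A, (r g (α (g • x)) *
          Real.exp (DK ν α K (a :: l) g x))) ν := by
        refine (meas_of_nm hmp hα (a :: l).toFinset _ ?_).2
        intro x y h
        refine Finset.prod_congr rfl fun g hg => ?_
        rw [DK_congr K (a :: l) g h, nm_eq_iff.1 h g (hA hg)]
      calc _ ≤ ∫ x, u x * r a (α (a • x)) *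
            (mm ν α l.toFinset x / mm ν α (insert a l.toFinset) x) ∂ν := by
            refine integral_mono_ae hintg i1 ?_
            filter_upwards [mm_pos hmp hα l.toFinset, mm_pos hmp hα (insert a l.toFinset)]
              with x h1 h2
            rw [← Finset.mul_prod_erase A _ haA, hcongr _ hB x, mul_comm, mul_assoc]
            refine mul_le_mul_of_nonneg_left ?_ (hu0 x)
            refine mul_le_mul_of_nonneg_left ?_ (hr _ _)
            simp only [DK, if_true]
            rw [hins]
            calc Real.exp (min K _) ≤ Real.exp (Real.log _) := Real.exp_le_exp.2 (min_le_right _ _)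
              _ = _ := Real.exp_log (div_pos h1 h2)
        _ ≤ (∑ i, r a i) * ∫ x, u x ∂ν := i2
        _ ≤ (∑ i, r a i) * ∏ g ∈ B, ∑ i, r g i :=
            mul_le_mul_of_nonneg_left (ih hl.2 B hB) (Finset.sum_nonneg fun i _ => hr a i)
        _ = _ := Finset.mul_prod_erase A (fun g => ∑ i, r g i) haA
    · have hB : A ⊆ l.toFinset := by
        intro b hb
        have h2 := hA hb
        rw [hins, Finset.mem_insert] at h2
        exact h2.resolve_left (fun h => haA (h ▸ hb))
      simp only [hcongr A hB]
      exact ih hl.2 A hB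

lemma log_le_trunc (K q : ℝ) (hq : 0 < q) :
    Real.log q ≤ min K (Real.log q) + Real.exp (-K) * q := by
  by_cases h : Real.log q ≤ K
  · rw [min_eq_right h]
    have : 0 < Real.exp (-K) * q := by positivity
    linarith
  · rw [min_eq_left (not_le.1 h).le]
    have h1 : Real.exp (-K) * q = Real.exp (Real.log q - K) := by
      rw [sub_eq_add_neg, Real.exp_add, Real.exp_log hq, mul_comm]
    have h2 := Real.add_one_le_exp (Real.log q - K)
    linarith

lemma sum_DK (hmp : ∀ g : G, MeasurePreserving (fun x : X => g • x) ν ν)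
    (hα : Measurable α) (K : ℝ) (l : List G) (hl : l.Nodup) :
    ∫ x, -Real.log (mm ν α l.toFinset x) ∂ν - l.length * (k * Real.exp (-K)) ≤
      ∑ g ∈ l.toFinset, ∫ x, DK ν α K l g x ∂ν := by
  induction l with
  | nil =>
    have : ∀ x, mm ν α (∅ : Finset G) x = 1 := by
      intro x
      have : {y | nm α (∅ : Finset G) y = nm α ∅ x} = univ := by
        ext y; simp [nm_eq_iff]
      unfold mm
      rw [this]; simp
    simp [this]
  | cons a l ih =>
    rw [List.nodup_cons] at hl
    have hsub : l.toFinset ⊆ (a :: l).toFinset := by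
      intro b hb; simp at hb ⊢; exact Or.inr hb
    have hins : (a :: l).toFinset = insert a l.toFinset := by simp
    have hna : a ∉ l.toFinset := by simpa using hl.1
    have hne : ∀ g ∈ l.toFinset, ∀ x, DK ν α K (a :: l) g x = DK ν α K l g x := by
      intro g hg x
      have : g ≠ a := fun h => hna (h ▸ hg)
      simp [DK, this]
    have e : ∑ g ∈ l.toFinset, ∫ x, DK ν α K (a :: l) g x ∂ν =
        ∑ g ∈ l.toFinset, ∫ x, DK ν α K l g x ∂ν := by
      refine Finset.sum_congr rfl fun g hg => ?_
      simp only [hne g hg]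
    have hstep := info_step_mm hmp hα l.toFinset a (fun _ => 1) (fun _ _ _ => rfl)
      (fun _ => zero_le_one) (fun _ => 1) (fun _ => zero_le_one)
    simp only [one_mul, mul_one, integral_const, probReal_univ, smul_eq_mul, Finset.sum_const,
      Finset.card_univ, Fintype.card_fin, nsmul_eq_mul] at hstep
    have iD : Integrable (fun x => DK ν α K (a :: l) a x) ν :=
      (meas_of_nm hmp hα _ _ fun x y h => DK_congr K (a :: l) a h).2
    have iL : ∀ S : Finset G, Integrable (fun x => Real.log (mm ν α S x)) ν := fun S =>
      (meas_of_nm hmp hα S _ fun x y h => by rw [mm_congr subset_rfl h]).2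
    have key : ∫ x, (Real.log (mm ν α l.toFinset x) - Real.log (mm ν α (a :: l).toFinset x)) ∂ν ≤
        ∫ x, (DK ν α K (a :: l) a x + Real.exp (-K) *
          (mm ν α l.toFinset x / mm ν α (insert a l.toFinset) x)) ∂ν := by
      refine integral_mono_ae ((iL _).sub (iL _)) (iD.add (hstep.1.const_mul _)) ?_
      filter_upwards [mm_pos hmp hα l.toFinset, mm_pos hmp hα (insert a l.toFinset)] with x h1 h2
      simp only [DK, if_true, hins]
      rw [← Real.log_div h1.ne' h2.ne']
      exact log_le_trunc K _ (div_pos h1 h2)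
    rw [integral_sub (iL _) (iL _), integral_add iD (hstep.1.const_mul _),
      integral_const_mul] at key
    have h3 := mul_le_mul_of_nonneg_left hstep.2 (Real.exp_pos (-K)).le
    have ih' := ih hl.2
    rw [integral_neg] at ih' ⊢
    have e2 : ∑ g ∈ (a :: l).toFinset, ∫ x, DK ν α K (a :: l) g x ∂ν =
        ∫ x, DK ν α K (a :: l) a x ∂ν + ∑ g ∈ l.toFinset, ∫ x, DK ν α K l g x ∂ν := by
      rw [← e]
      conv_lhs => rw [hins]
      rw [Finset.sum_insert hna]
    rw [e2]
    push_cast [List.length_cons]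
    nlinarith

lemma partitionEntropy_eq (hmp : ∀ g : G, MeasurePreserving (fun x : X => g • x) ν ν)
    (hα : Measurable α) (S : Finset G) :
    partitionEntropy ν α S = ∫ x, -Real.log (mm ν α S x) ∂ν := by
  have h := (integral_comp_fin (ν := ν) (nm α S) (measurable_nm hmp hα S)
    (fun t => -Real.log (ν.real {y | nm α S y = t}))).2
  unfold mm
  rw [h]
  unfold partitionEntropy
  refine Finset.sum_congr rfl fun t _ => ?_
  have : {x | ∀ g : ↥S, α ((g : G) • x) = t g} = {y | nm α S y = t} := by
    ext y
    simp only [mem_ofPred_eq, funext_iff]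
    rfl
  rw [this, Real.negMulLog, measureReal_def]
  ring

end Info

section InfoLimit

set_option linter.unusedSectionVars false

variable {G : Type*} [Group G] [DecidableEq G] {X : Type*} [MeasurableSpace X] [MulAction G X]
  {k : ℕ} {ν : Measure X} [IsProbabilityMeasure ν] {α : X → Fin k}

/-- averaged information function -/
noncomputable def Jfn (ν : Measure X) (α : X → Fin k) (K : ℝ) (W : Finset G) (x : X) : ℝ :=
  (∑ a ∈ W, DK ν α K W.toList a (a⁻¹ • x)) / W.card

lemma DK_meas (hmp : ∀ g : G, MeasurePreserving (fun x : X => g • x) ν ν)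
    (hα : Measurable α) (K : ℝ) (l : List G) (g : G) : Measurable (DK ν α K l g) :=
  (meas_of_nm hmp hα _ _ fun _ _ h => DK_congr K l g h).1

lemma Jfn_meas (hmp : ∀ g : G, MeasurePreserving (fun x : X => g • x) ν ν)
    (hα : Measurable α) (K : ℝ) (W : Finset G) : Measurable (Jfn ν α K W) := by
  unfold Jfn
  refine Measurable.div_const ?_ _
  exact Finset.measurable_fun_sum _ fun a _ => (DK_meas hmp hα K _ a).comp (hmp a⁻¹).measurable

lemma Jfn_bound (K : ℝ) (hK : 0 ≤ K) (W : Finset G) (hW : W.Nonempty) (x : X) :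
    0 ≤ Jfn ν α K W x ∧ Jfn ν α K W x ≤ K := by
  have hc : (0 : ℝ) < W.card := by exact_mod_cast hW.card_pos
  unfold Jfn
  constructor
  · exact div_nonneg (Finset.sum_nonneg fun a _ => (DK_bound K hK _ _ _).1) hc.le
  · rw [div_le_iff₀ hc]
    calc _ ≤ ∑ a ∈ W, K := Finset.sum_le_sum fun a _ => (DK_bound K hK _ _ _).2
      _ = _ := by simp [mul_comm]

lemma integrable_bdd {f : X → ℝ} (hf : Measurable f) (L : ℝ) (hL : ∀ x, |f x| ≤ L) :
    Integrable f ν := Integrable.of_bound hf.aestronglyMeasurable L (Eventually.of_forall hL)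

lemma Jfn_integral (hmp : ∀ g : G, MeasurePreserving (fun x : X => g • x) ν ν)
    (hα : Measurable α) (K : ℝ) (hK : 0 ≤ K) (W : Finset G) (hW : W.Nonempty) :
    partitionEntropy ν α W / W.card - k * Real.exp (-K) ≤ ∫ x, Jfn ν α K W x ∂ν := by
  have hc : (0 : ℝ) < W.card := by exact_mod_cast hW.card_pos
  have h1 := sum_DK hmp hα K W.toList W.nodup_toList
  rw [Finset.toList_toFinset, Finset.length_toList, ← partitionEntropy_eq hmp hα] at h1
  unfold Jfn
  rw [integral_div, le_div_iff₀ hc, integral_finsetSum]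
  · have e : ∀ a ∈ W, ∫ x, DK ν α K W.toList a (a⁻¹ • x) ∂ν = ∫ x, DK ν α K W.toList a x ∂ν :=
      fun a _ => integral_smul_eq' hmp a⁻¹ _ (DK_meas hmp hα K _ a).aestronglyMeasurable
    rw [Finset.sum_congr rfl e]
    refine le_trans (le_of_eq ?_) h1
    field_simp
  · intro a _
    refine integrable_bdd ((DK_meas hmp hα K _ a).comp (hmp a⁻¹).measurable) K fun x => ?_
    have := DK_bound (ν := ν) (α := α) K hK W.toList a (a⁻¹ • x)
    exact abs_le.2 ⟨by linarith [this.1], this.2⟩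

/-- interior of W relative to A -/
def coreW (A W : Finset G) : Finset G := W.filter fun c => ∀ g ∈ A, g * c ∈ W

lemma coreW_card (A W : Finset G) :
    (W.card : ℝ) - (coreW A W).card ≤ ∑ g ∈ A, ((symmDiff W (W.image (g * ·))).card : ℝ) := by
  have h1 : W ⊆ coreW A W ∪ A.biUnion fun g => W.filter fun c => g * c ∉ W := by
    intro c hc
    by_cases h : ∀ g ∈ A, g * c ∈ W
    · exact Finset.mem_union_left _ (Finset.mem_filter.2 ⟨hc, h⟩)
    · push Not at h
      obtain ⟨g, hg, hgc⟩ := h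
      exact Finset.mem_union_right _ (Finset.mem_biUnion.2 ⟨g, hg, Finset.mem_filter.2 ⟨hc, hgc⟩⟩)
  have h2 : W.card ≤ (coreW A W).card + ∑ g ∈ A, (symmDiff W (W.image (g * ·))).card := by
    refine (Finset.card_le_card h1).trans ((Finset.card_union_le _ _).trans ?_)
    refine Nat.add_le_add_left (Finset.card_biUnion_le.trans ?_) _
    refine Finset.sum_le_sum fun g _ => ?_
    refine Finset.card_le_card_of_injOn (g * ·) ?_ (mul_right_injective g).injOn
    intro c hc
    have hc' := Finset.mem_filter.1 hc
    refine Finset.mem_coe.2 (Finset.mem_symmDiff.2 (Or.inr ⟨?_, hc'.2⟩))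
    exact Finset.mem_image.2 ⟨c, hc'.1, rfl⟩
  have h3 : (W.card : ℝ) ≤ (coreW A W).card + ∑ g ∈ A, ((symmDiff W (W.image (g * ·))).card : ℝ) := by
    exact_mod_cast h2
  linarith

lemma core_int (hmp : ∀ g : G, MeasurePreserving (fun x : X => g • x) ν ν)
    (hα : Measurable α) (K : ℝ) (W A : Finset G) (c : G) (hc : c ∈ coreW A W)
    (r : G → Fin k → ℝ) (hr : ∀ g i, 0 ≤ r g i) :
    ∫ x, ∏ g ∈ A, (r g (α (g • x)) * Real.exp (DK ν α K W.toList (g * c) (c⁻¹ • x))) ∂ν ≤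
      ∏ g ∈ A, ∑ i, r g i := by
  have hm : Measurable (fun x => ∏ g ∈ A, (r g (α (g • x)) *
      Real.exp (DK ν α K W.toList (g * c) (c⁻¹ • x)))) := by
    refine Finset.measurable_fun_prod _ fun g _ => ?_
    exact ((measurable_of_finite (r g)).comp (hα.comp (hmp g).measurable)).mul
      (Real.measurable_exp.comp ((DK_meas hmp hα K _ _).comp (hmp c⁻¹).measurable))
  rw [← integral_smul_eq' hmp c _ hm.aestronglyMeasurable]
  have hsub : A.image (· * c) ⊆ W.toList.toFinset := by
    intro h hh
    obtain ⟨g, hg, rfl⟩ := Finset.mem_image.1 hh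
    rw [Finset.toList_toFinset]
    exact (Finset.mem_filter.1 hc).2 g hg
  have h1 := prod_DK hmp hα K W.toList W.nodup_toList (A.image (· * c)) hsub
    (fun h => r (h * c⁻¹)) (fun h i => hr _ _)
  rw [Finset.prod_image (mul_left_injective c).injOn] at h1
  simp only [Finset.prod_image (mul_left_injective c).injOn, mul_inv_cancel_right] at h1
  simpa only [smul_smul, inv_mul_cancel, one_smul] using h1

lemma Jfn_core (K : ℝ) (hK : 0 ≤ K) (W A : Finset G) (g : G) (hg : g ∈ A) (x : X) :
    ∑ a ∈ W, DK ν α K W.toList a (a⁻¹ • g • x) ≤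
      ∑ c ∈ coreW A W, DK ν α K W.toList (g * c) (c⁻¹ • x) +
        K * (W.card - (coreW A W).card) := by
  have hsub : (coreW A W).image (g * ·) ⊆ W := by
    intro a ha
    obtain ⟨c, hc, rfl⟩ := Finset.mem_image.1 ha
    exact (Finset.mem_filter.1 hc).2 g hg
  rw [← Finset.sum_sdiff hsub, Finset.sum_image (mul_right_injective g).injOn, add_comm]
  have e : ∀ c, DK ν α K W.toList (g * c) ((g * c)⁻¹ • g • x) =
      DK ν α K W.toList (g * c) (c⁻¹ • x) := by
    intro c; rw [smul_smul]; simp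
  simp only [e]
  refine add_le_add le_rfl ?_
  calc _ ≤ ∑ a ∈ W \ (coreW A W).image (g * ·), K :=
        Finset.sum_le_sum fun a _ => (DK_bound K hK _ _ _).2
    _ = _ := by
      rw [Finset.sum_const, nsmul_eq_mul, mul_comm, Finset.cast_card_sdiff hsub,
        Finset.card_image_of_injective _ (mul_right_injective g)]

lemma info_fin (hmp : ∀ g : G, MeasurePreserving (fun x : X => g • x) ν ν)
    (hα : Measurable α) (K : ℝ) (hK : 0 ≤ K) (W A : Finset G) (hW : W.Nonempty)
    (r : G → Fin k → ℝ) (hr : ∀ g i, 0 ≤ r g i) (s : X → ℝ) (hs : Measurable s) (L : ℝ)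
    (hL : ∀ x, |s x| ≤ L) (ρ : ℝ) (hρ : ρ = (coreW A W).card / W.card) :
    ∫ x, (∏ g ∈ A, r g (α (g • x))) * Real.exp (s x) *
      (ρ * (1 - s x) + ∑ g ∈ A, Jfn ν α K W (g • x) - K * A.card * (1 - ρ)) ∂ν
      ≤ ρ * ∏ g ∈ A, ∑ i, r g i := by
  have hc : (0 : ℝ) < W.card := by exact_mod_cast hW.card_pos
  set P : G → X → ℝ := fun c x => ∏ g ∈ A, (r g (α (g • x)) *
      Real.exp (DK ν α K W.toList (g * c) (c⁻¹ • x))) with hP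
  have hPm : ∀ c, Measurable (P c) := by
    intro c
    refine Finset.measurable_fun_prod _ fun g _ => ?_
    exact ((measurable_of_finite (r g)).comp (hα.comp (hmp g).measurable)).mul
      (Real.measurable_exp.comp ((DK_meas hmp hα K _ _).comp (hmp c⁻¹).measurable))
  have hP0 : ∀ c x, 0 ≤ P c x := fun c x =>
    Finset.prod_nonneg fun g _ => mul_nonneg (hr _ _) (Real.exp_pos _).le
  have hPi : ∀ c, Integrable (P c) ν := by
    intro c
    refine integrable_bdd (hPm c) (∏ g ∈ A, ((∑ i, r g i) * Real.exp K)) fun x => ?_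
    rw [abs_of_nonneg (hP0 c x)]
    refine Finset.prod_le_prod (fun g _ => mul_nonneg (hr _ _) (Real.exp_pos _).le) fun g _ => ?_
    exact mul_le_mul (Finset.single_le_sum (fun i _ => hr g i) (Finset.mem_univ _))
      (Real.exp_le_exp.2 (DK_bound K hK _ _ _).2) (Real.exp_pos _).le
      (Finset.sum_nonneg fun i _ => hr g i)
  have hpt : ∀ x, (∏ g ∈ A, r g (α (g • x))) * Real.exp (s x) *
      (ρ * (1 - s x) + ∑ g ∈ A, Jfn ν α K W (g • x) - K * A.card * (1 - ρ)) ≤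
      (∑ c ∈ coreW A W, P c x) / W.card := by
    intro x
    set R := ∏ g ∈ A, r g (α (g • x)) with hR
    have hR0 : 0 ≤ R := Finset.prod_nonneg fun g _ => hr _ _
    set t : G → ℝ := fun c => ∑ g ∈ A, DK ν α K W.toList (g * c) (c⁻¹ • x) with ht
    have hPt : ∀ c, P c x = R * Real.exp (t c) := by
      intro c
      simp only [hP, ht]
      rw [Finset.prod_mul_distrib, Real.exp_sum]
    have hsum : ∑ g ∈ A, Jfn ν α K W (g • x) ≤
        (∑ c ∈ coreW A W, t c) / W.card + K * A.card * (1 - ρ) := by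
      have : ∑ g ∈ A, ∑ a ∈ W, DK ν α K W.toList a (a⁻¹ • g • x) ≤
        ∑ g ∈ A, (∑ c ∈ coreW A W, DK ν α K W.toList (g * c) (c⁻¹ • x) +
        K * (W.card - (coreW A W).card)) :=
        Finset.sum_le_sum fun g hg => Jfn_core K hK W A g hg x
      rw [Finset.sum_add_distrib, Finset.sum_comm, Finset.sum_const, nsmul_eq_mul] at this
      unfold Jfn
      rw [← Finset.sum_div, div_le_iff₀ hc, add_mul, div_mul_cancel₀ _ hc.ne', hρ]
      rw [Finset.sum_comm]
      refine this.trans (le_of_eq ?_)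
      rw [Finset.sum_comm]
      simp only [ht]
      field_simp
    have h1 : ρ * (1 - s x) + ∑ g ∈ A, Jfn ν α K W (g • x) - K * A.card * (1 - ρ) ≤
        (∑ c ∈ coreW A W, (1 - s x + t c)) / W.card := by
      rw [Finset.sum_add_distrib, Finset.sum_const, nsmul_eq_mul, add_div]
      have : (coreW A W).card * (1 - s x) / W.card = ρ * (1 - s x) := by rw [hρ]; ring
      rw [this]; linarith
    refine (mul_le_mul_of_nonneg_left h1 (mul_nonneg hR0 (Real.exp_pos _).le)).trans ?_
    rw [← mul_div_assoc, Finset.mul_sum]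
    refine div_le_div_of_nonneg_right (Finset.sum_le_sum fun c _ => ?_) hc.le
    rw [hPt, mul_assoc]
    refine mul_le_mul_of_nonneg_left ?_ hR0
    have h2 := Real.add_one_le_exp (t c - s x)
    calc Real.exp (s x) * (1 - s x + t c) ≤ Real.exp (s x) * Real.exp (t c - s x) :=
          mul_le_mul_of_nonneg_left (by linarith) (Real.exp_pos _).le
      _ = Real.exp (t c) := by rw [← Real.exp_add]; congr 1; ring
  have hle : ∫ x, (∏ g ∈ A, r g (α (g • x))) * Real.exp (s x) *
      (ρ * (1 - s x) + ∑ g ∈ A, Jfn ν α K W (g • x) - K * A.card * (1 - ρ)) ∂ν ≤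
      ∫ x, (∑ c ∈ coreW A W, P c x) / W.card ∂ν := by
    refine integral_mono ?_ ((integrable_finsetSum _ fun c _ => hPi c).div_const _) hpt
    have hRm : Measurable fun x => ∏ g ∈ A, r g (α (g • x)) :=
      Finset.measurable_fun_prod _ fun g _ =>
        (measurable_of_finite (r g)).comp (hα.comp (hmp g).measurable)
    have hJm : Measurable fun x => ∑ g ∈ A, Jfn ν α K W (g • x) :=
      Finset.measurable_fun_sum _ fun g _ => (Jfn_meas hmp hα K W).comp (hmp g).measurable
    refine integrable_bdd ?_ ((∏ g ∈ A, ∑ i, r g i) * Real.exp L *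
      (|ρ| * (1 + L) + A.card * K + |K * A.card * (1 - ρ)|)) fun x => ?_
    · exact (hRm.mul (Real.measurable_exp.comp hs)).mul
        (((measurable_const.mul (measurable_const.sub hs)).add hJm).sub measurable_const)
    · have hR0 : 0 ≤ ∏ g ∈ A, r g (α (g • x)) := Finset.prod_nonneg fun g _ => hr _ _
      rw [abs_mul, abs_mul, abs_of_nonneg hR0, abs_of_pos (Real.exp_pos _)]
      have hRb : ∏ g ∈ A, r g (α (g • x)) ≤ ∏ g ∈ A, ∑ i, r g i :=
        Finset.prod_le_prod (fun g _ => hr _ _) fun g _ =>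
          Finset.single_le_sum (fun i _ => hr g i) (Finset.mem_univ _)
      refine mul_le_mul (mul_le_mul hRb (Real.exp_le_exp.2 (le_of_abs_le (hL x)))
        (Real.exp_pos _).le (hR0.trans hRb)) ?_ (abs_nonneg _) (mul_nonneg (hR0.trans hRb) (Real.exp_pos _).le)
      refine (abs_sub _ _).trans (add_le_add ((abs_add_le _ _).trans (add_le_add ?_ ?_)) le_rfl)
      · rw [abs_mul]
        refine mul_le_mul_of_nonneg_left ?_ (abs_nonneg _)
        refine (abs_sub _ _).trans ?_
        rw [abs_one]; linarith [hL x]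
      · rw [abs_of_nonneg (Finset.sum_nonneg fun g _ => (Jfn_bound K hK W hW _).1)]
        calc _ ≤ ∑ g ∈ A, K := Finset.sum_le_sum fun g _ => (Jfn_bound K hK W hW _).2
          _ = _ := by simp
  refine hle.trans ?_
  rw [integral_div, integral_finsetSum _ fun c _ => hPi c, div_le_iff₀ hc]
  calc _ ≤ ∑ c ∈ coreW A W, ∏ g ∈ A, ∑ i, r g i :=
        Finset.sum_le_sum fun c hcc => core_int hmp hα K W A c hcc r hr
    _ = _ := by
      rw [Finset.sum_const, nsmul_eq_mul, hρ]; field_simp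

lemma info_limit (hmp : ∀ g : G, MeasurePreserving (fun x : X => g • x) ν ν)
    (hα : Measurable α) (F : ℕ → Finset G) (hF : IsFolnerSeq F) (K : ℝ) (hK : 0 ≤ K) (c' : ℝ)
    (hfreq : ∃ᶠ n in atTop, c' < partitionEntropy ν α (F n) / (F n).card) :
    ∃ J : X → ℝ, Measurable J ∧ (∀ x, 0 ≤ J x ∧ J x ≤ K) ∧
      c' - k * Real.exp (-K) ≤ ∫ x, J x ∂ν ∧
      ∀ (A : Finset G) (r : G → Fin k → ℝ), (∀ g i, 0 ≤ r g i) →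
        ∫ x, (∏ g ∈ A, r g (α (g • x))) * Real.exp (∑ g ∈ A, J (g • x)) ∂ν ≤
          ∏ g ∈ A, ∑ i, r g i := by
  set S : Set ℕ := {n | c' < partitionEntropy ν α (F n) / (F n).card} with hS
  have : NeBot (atTop ⊓ 𝓟 S) := Filter.frequently_mem_iff_neBot.1 hfreq
  set U : Ultrafilter ℕ := Ultrafilter.of (atTop ⊓ 𝓟 S)
  have hU : (U : Filter ℕ) ≤ atTop ⊓ 𝓟 S := Ultrafilter.of_le _
  have hUtop : (U : Filter ℕ) ≤ atTop := hU.trans inf_le_left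
  have hUS : S ∈ (U : Filter ℕ) := le_principal_iff.1 (hU.trans inf_le_right)
  have hJb := fun m x => Jfn_bound (ν := ν) (α := α) K hK (F m) (hF.1 m) x
  have hJm := fun m => Jfn_meas hmp hα K (F m)
  obtain ⟨J, hJ, hJK, hlim⟩ := exists_weak_limit (ν := ν) (fun m => Jfn ν α K (F m)) hJm K hJb U
  refine ⟨J, hJ, hJK, ?_, ?_⟩
  · have h1 := hlim (fun _ => 1) measurable_const ⟨1, fun x => by simp⟩
    simp only [mul_one] at h1
    refine ge_of_tendsto h1 ?_
    filter_upwards [hUS] with m hm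
    have h2 := Jfn_integral hmp hα K hK (F m) (hF.1 m)
    have h3 : c' < partitionEntropy ν α (F m) / (F m).card := hm
    linarith
  · intro A r hr
    set s : X → ℝ := fun x => ∑ g ∈ A, J (g • x) with hs
    have hsm : Measurable s := Finset.measurable_fun_sum _ fun g _ => hJ.comp (hmp g).measurable
    have hsb : ∀ x, |s x| ≤ A.card * K := by
      intro x
      rw [abs_of_nonneg (Finset.sum_nonneg fun g _ => (hJK _).1)]
      calc s x ≤ ∑ g ∈ A, K := Finset.sum_le_sum fun g _ => (hJK _).2
        _ = _ := by simp
    set B := ∏ g ∈ A, ∑ i, r g i with hB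
    set φ : X → ℝ := fun x => (∏ g ∈ A, r g (α (g • x))) * Real.exp (s x) with hφ
    have hφm : Measurable φ := by
      have hRm : Measurable fun x => ∏ g ∈ A, r g (α (g • x)) :=
        Finset.measurable_fun_prod _ fun g _ =>
          (measurable_of_finite (r g)).comp (hα.comp (hmp g).measurable)
      exact hRm.mul (Real.measurable_exp.comp hsm)
    have hφb : ∀ x, |φ x| ≤ B * Real.exp (A.card * K) := by
      intro x
      have hR0 : 0 ≤ ∏ g ∈ A, r g (α (g • x)) := Finset.prod_nonneg fun g _ => hr _ _
      have hRb : ∏ g ∈ A, r g (α (g • x)) ≤ ∏ g ∈ A, ∑ i, r g i :=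
        Finset.prod_le_prod (fun g _ => hr _ _) fun g _ =>
          Finset.single_le_sum (fun i _ => hr g i) (Finset.mem_univ _)
      simp only [hφ]
      rw [abs_mul, abs_of_nonneg hR0, abs_of_pos (Real.exp_pos _)]
      exact mul_le_mul hRb (Real.exp_le_exp.2 (le_of_abs_le (hsb x))) (Real.exp_pos _).le
        (hR0.trans hRb)
    set Lφ := B * Real.exp (A.card * K) with hLφ
    have hLφ0 : 0 ≤ Lφ := by
      rw [hLφ]
      exact mul_nonneg (Finset.prod_nonneg fun g _ => Finset.sum_nonneg fun i _ => hr g i)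
        (Real.exp_pos _).le
    have hiφ : Integrable φ ν := integrable_bdd hφm _ hφb
    have hiφs : Integrable (fun x => φ x * (1 - s x)) ν := by
      refine integrable_bdd (hφm.mul (measurable_const.sub hsm)) (Lφ * (1 + A.card * K)) fun x => ?_
      rw [abs_mul]
      refine mul_le_mul (hφb x) ?_ (abs_nonneg _) hLφ0
      refine (abs_sub _ _).trans ?_
      rw [abs_one]; linarith [hsb x]
    have hiJ : ∀ (f : X → ℝ), Measurable f → (∀ x, 0 ≤ f x ∧ f x ≤ K) → ∀ g : G,
        Integrable (fun x => f (g • x) * φ x) ν := by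
      intro f hf hfK g
      refine integrable_bdd ((hf.comp (hmp g).measurable).mul hφm) (K * Lφ) fun x => ?_
      rw [abs_mul]
      refine mul_le_mul ?_ (hφb x) (abs_nonneg _) hK
      exact abs_le.2 ⟨by linarith [(hfK (g • x)).1], (hfK (g • x)).2⟩
    have hshift : ∀ (f : X → ℝ), Measurable f → ∀ g : G,
        ∫ x, f (g • x) * φ x ∂ν = ∫ x, f x * φ (g⁻¹ • x) ∂ν := by
      intro f hf g
      have := integral_smul_eq' hmp g (fun x => f x * φ (g⁻¹ • x))
        (hf.mul (hφm.comp (hmp g⁻¹).measurable)).aestronglyMeasurable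
      simpa only [inv_smul_smul] using this
    set ρ : ℕ → ℝ := fun m => (coreW A (F m)).card / (F m).card with hρ
    have hρlim : Tendsto ρ atTop (𝓝 1) := by
      have h1 : Tendsto (fun m => ∑ g ∈ A,
          ((symmDiff (F m) ((F m).image (g * ·))).card : ℝ) / (F m).card) atTop (𝓝 0) := by
        have := tendsto_finsetSum A fun g _ => hF.2 g
        simpa using this
      have h2 : Tendsto (fun m => 1 - ρ m) atTop (𝓝 0) := by
        refine squeeze_zero (fun m => ?_) (fun m => ?_) h1
        · have hc : (0 : ℝ) < (F m).card := by exact_mod_cast (hF.1 m).card_pos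
          rw [sub_nonneg, hρ]
          refine (div_le_one hc).2 ?_
          exact_mod_cast Finset.card_le_card (Finset.filter_subset _ _)
        · have hc : (0 : ℝ) < (F m).card := by exact_mod_cast (hF.1 m).card_pos
          rw [← Finset.sum_div, le_div_iff₀ hc]
          refine le_trans (le_of_eq ?_) (coreW_card A (F m))
          simp only [hρ]; field_simp
      have := h2.const_sub 1
      simpa using this
    have hineq : ∀ m, ρ m * ∫ x, φ x * (1 - s x) ∂ν +
        ∑ g ∈ A, ∫ x, Jfn ν α K (F m) x * φ (g⁻¹ • x) ∂ν -
          K * A.card * (1 - ρ m) * ∫ x, φ x ∂ν ≤ ρ m * B := by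
      intro m
      have h1 := info_fin hmp hα K hK (F m) A (hF.1 m) r hr s hsm _ hsb (ρ m) rfl
      refine le_trans (le_of_eq ?_) h1
      have e : ∀ x, (∏ g ∈ A, r g (α (g • x))) * Real.exp (s x) *
          (ρ m * (1 - s x) + ∑ g ∈ A, Jfn ν α K (F m) (g • x) - K * A.card * (1 - ρ m)) =
          ρ m * (φ x * (1 - s x)) + ∑ g ∈ A, Jfn ν α K (F m) (g • x) * φ x -
            K * A.card * (1 - ρ m) * φ x := by
        intro x
        simp only [hφ]
        rw [← Finset.sum_mul]
        ring
      simp only [e]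
      have i1 := hiφs.const_mul (ρ m)
      have i2 : ∀ g ∈ A, Integrable (fun x => Jfn ν α K (F m) (g • x) * φ x) ν :=
        fun g _ => hiJ _ (hJm m) (hJb m) g
      have i3 := hiφ.const_mul (K * A.card * (1 - ρ m))
      have i12 : Integrable (fun x => ρ m * (φ x * (1 - s x)) +
          ∑ g ∈ A, Jfn ν α K (F m) (g • x) * φ x) ν := i1.add (integrable_finsetSum _ i2)
      rw [integral_sub i12 i3,
        integral_add i1 (integrable_finsetSum _ i2), integral_finsetSum _ i2,
        integral_const_mul, integral_const_mul]
      simp only [hshift _ (hJm m)]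
    have hρU := hρlim.mono_left hUtop
    have hleft := ((hρU.mul_const (∫ x, φ x * (1 - s x) ∂ν)).add
      (tendsto_finsetSum A fun g _ => hlim (fun x => φ (g⁻¹ • x))
        (hφm.comp (hmp g⁻¹).measurable) ⟨Lφ, fun x => hφb _⟩)).sub
      (((hρU.const_sub 1).const_mul (K * A.card)).mul_const (∫ x, φ x ∂ν))
    have hfin := le_of_tendsto_of_tendsto' hleft (hρU.mul_const B) hineq
    simp only [← hshift _ hJ] at hfin
    rw [← integral_finsetSum _ fun g _ => hiJ J hJ hJK g] at hfin
    rw [one_mul, one_mul, sub_self, mul_zero, zero_mul, sub_zero,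
      ← integral_add hiφs (integrable_finsetSum _ fun g _ => hiJ J hJ hJK g)] at hfin
    refine le_trans (le_of_eq ?_) hfin
    congr 1
    ext x
    rw [← Finset.sum_mul]
    simp only [hφ, hs]
    ring

end InfoLimit

section TheoremA

set_option linter.unusedSectionVars false

lemma growth_summable {G : Type*} (F : ℕ → Finset G) [Group G] [DecidableEq G]
    (hG : GrowthCond F) (ε : ℝ) (hε : 0 < ε) :
    Summable fun n => Real.exp (-(ε * (F n).card)) := by
  have h1 : Summable fun n : ℕ => 1 / (n : ℝ) ^ 2 := Real.summable_one_div_nat_pow.2 (by norm_num)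
  refine summable_of_isBigO_nat h1 ?_
  refine Asymptotics.IsBigO.of_bound 1 ?_
  have h2 := hG.eventually_ge_atTop (2 / ε)
  filter_upwards [h2, eventually_ge_atTop 2] with n hn hn2
  have hn2' : (2 : ℝ) ≤ n := by exact_mod_cast hn2
  have hlog : 0 < Real.log n := Real.log_pos (by linarith)
  rw [le_div_iff₀ hlog] at hn
  have h3 : 2 * Real.log n ≤ ε * (F n).card := by
    have := mul_le_mul_of_nonneg_left hn hε.le
    have e : ε * (2 / ε * Real.log n) = 2 * Real.log n := by field_simp
    linarith
  rw [Real.norm_of_nonneg (Real.exp_pos _).le, one_mul, Real.norm_of_nonneg (by positivity)]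
  calc Real.exp (-(ε * (F n).card)) ≤ Real.exp (-(2 * Real.log n)) :=
        Real.exp_le_exp.2 (by linarith)
    _ = 1 / (n : ℝ) ^ 2 := by
      rw [Real.exp_neg, mul_comm, Real.exp_mul, Real.exp_log (by linarith), one_div]
      norm_num

lemma ae_eventually_le_one {X : Type*} [MeasurableSpace X] {ν : Measure X}
    (Z : ℕ → X → ℝ) (hZ : ∀ n, Integrable (Z n) ν) (hZ0 : ∀ n x, 0 ≤ Z n x) (b : ℕ → ℝ)
    (hb : Summable b) (hZb : ∀ n, ∫ x, Z n x ∂ν ≤ b n) :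
    ∀ᵐ x ∂ν, ∀ᶠ n in atTop, Z n x ≤ 1 := by
  have hb0 : ∀ n, 0 ≤ b n := fun n => (integral_nonneg (hZ0 n)).trans (hZb n)
  have h1 : ∫⁻ x, ∑' n, ENNReal.ofReal (Z n x) ∂ν ≠ ⊤ := by
    rw [lintegral_tsum fun n => (hZ n).aemeasurable.ennreal_ofReal]
    have : ∀ n, ∫⁻ x, ENNReal.ofReal (Z n x) ∂ν ≤ ENNReal.ofReal (b n) := by
      intro n
      rw [← ofReal_integral_eq_lintegral_ofReal (hZ n) (Eventually.of_forall (hZ0 n))]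
      exact ENNReal.ofReal_le_ofReal (hZb n)
    refine ne_top_of_le_ne_top ?_ (ENNReal.tsum_le_tsum this)
    rw [← ENNReal.ofReal_tsum_of_nonneg hb0 hb]
    exact ENNReal.ofReal_ne_top
  have h2 := ae_lt_top' (AEMeasurable.tsum fun n => (hZ n).aemeasurable.ennreal_ofReal) h1
  filter_upwards [h2] with x hx
  have h3 := ENNReal.tendsto_atTop_zero_of_tsum_ne_top hx.ne
  filter_upwards [h3.eventually (ge_mem_nhds (show (0 : ℝ≥0∞) < 1 by simp))] with n hn
  exact ENNReal.ofReal_le_one.1 hn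

variable {G : Type*} [Group G] [DecidableEq G] {X : Type*} [MeasurableSpace X] [MulAction G X]
  {k : ℕ} {ν : Measure X} [IsProbabilityMeasure ν] {α : X → Fin k}

lemma fubini_bound
    (hα : Measurable α) (μ : Measure X) [IsProbabilityMeasure μ]
    (hsm : ∀ g : G, Measurable fun x : X => g • x) (A : Finset G)
    (r : Fin k → X → ℝ) (hr : ∀ i, Measurable (r i)) (hr0 : ∀ i y, 0 ≤ r i y ∧ r i y ≤ 1)
    (E : ℝ) (hE : ∀ y, ∑ i, r i y ≤ E) (s : X → ℝ) (hs : Measurable s) (L : ℝ)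
    (hL : ∀ x, |s x| ≤ L)
    (h : ∀ r : G → Fin k → ℝ, (∀ g i, 0 ≤ r g i) →
        ∫ x, (∏ g ∈ A, r g (α (g • x))) * Real.exp (s x) ∂ν ≤ ∏ g ∈ A, ∑ i, r g i) :
    Integrable (fun x => (∫ y, ∏ g ∈ A, r (α (g • x)) (g • y) ∂μ) * Real.exp (s x)) ν ∧
    ∫ x, (∫ y, ∏ g ∈ A, r (α (g • x)) (g • y) ∂μ) * Real.exp (s x) ∂ν ≤ E ^ A.card := by
  have hru : Measurable fun z : Fin k × X => r z.1 z.2 :=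
    measurable_from_prod_countable_right hr
  have hprod : Measurable fun z : X × X =>
      (∏ g ∈ A, r (α (g • z.1)) (g • z.2)) * Real.exp (s z.1) := by
    refine Measurable.mul ?_ (Real.measurable_exp.comp (hs.comp measurable_fst))
    refine Finset.measurable_fun_prod _ fun g _ => ?_
    exact hru.comp ((hα.comp ((hsm g).comp measurable_fst)).prodMk ((hsm g).comp measurable_snd))
  have hb : ∀ z : X × X, |(∏ g ∈ A, r (α (g • z.1)) (g • z.2)) * Real.exp (s z.1)| ≤ Real.exp L := by
    intro z
    have h0 : 0 ≤ ∏ g ∈ A, r (α (g • z.1)) (g • z.2) := Finset.prod_nonneg fun g _ => (hr0 _ _).1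
    rw [abs_mul, abs_of_nonneg h0, abs_of_pos (Real.exp_pos _)]
    calc _ ≤ 1 * Real.exp L := mul_le_mul (Finset.prod_le_one (fun g _ => (hr0 _ _).1)
            fun g _ => (hr0 _ _).2) (Real.exp_le_exp.2 (le_of_abs_le (hL _))) (Real.exp_pos _).le
              zero_le_one
      _ = _ := one_mul _
  have hi : Integrable (fun z : X × X =>
      (∏ g ∈ A, r (α (g • z.1)) (g • z.2)) * Real.exp (s z.1)) (ν.prod μ) :=
    integrable_bdd hprod _ hb
  have e : ∀ x, (∫ y, ∏ g ∈ A, r (α (g • x)) (g • y) ∂μ) * Real.exp (s x) =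
      ∫ y, (∏ g ∈ A, r (α (g • x)) (g • y)) * Real.exp (s x) ∂μ := by
    intro x; rw [integral_mul_const]
  simp only [e]
  refine ⟨hi.integral_prod_left, ?_⟩
  rw [integral_integral_swap hi]
  have hpt : ∀ y, ∫ x, (∏ g ∈ A, r (α (g • x)) (g • y)) * Real.exp (s x) ∂ν ≤ E ^ A.card := by
    intro y
    refine (h (fun g i => r i (g • y)) fun g i => (hr0 _ _).1).trans ?_
    rw [← Finset.prod_const]
    exact Finset.prod_le_prod (fun g _ => Finset.sum_nonneg fun i _ => (hr0 _ _).1)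
      fun g _ => hE _
  calc _ ≤ ∫ y, E ^ A.card ∂μ := integral_mono hi.integral_prod_right (integrable_const _) hpt
    _ = _ := by simp

end TheoremA

section TheoremA2

set_option linter.unusedSectionVars false

variable {G : Type*} [Group G] [DecidableEq G] {X : Type*} [MetricSpace X] [CompactSpace X]
  [MulAction G X] [ContinuousConstSMul G X] [MeasurableSpace X] [BorelSpace X]
  {k : ℕ} {ν : Measure X} [IsProbabilityMeasure ν] {α : X → Fin k}

lemma good_sets (hα : Measurable α) (γ : ℝ) (hγ : 0 < γ) :
    ∃ C : Fin k → Set X, (∀ i, IsClosed (C i)) ∧ (∀ i, C i ⊆ α ⁻¹' {i}) ∧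
      ν.real (⋃ i, C i)ᶜ ≤ γ ∧ ∃ δ : ℝ, 0 < δ ∧
        ∀ i j, i ≠ j → Disjoint (Metric.thickening δ (C i)) (Metric.thickening δ (C j)) := by
  have hγk : (0 : ℝ) < γ / (k + 1) := by positivity
  have h1 : ∀ i : Fin k, ∃ C, C ⊆ α ⁻¹' {i} ∧ IsClosed C ∧
      ν (α ⁻¹' {i} \ C) < ENNReal.ofReal (γ / (k + 1)) := by
    intro i
    exact (hα (measurableSet_singleton i)).exists_isClosed_sdiff_lt (measure_ne_top _ _)
      (by simpa using hγk)
  choose C hCs hCc hCν using h1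
  refine ⟨C, hCc, hCs, ?_, ?_⟩
  · have hsub : (⋃ i, C i)ᶜ ⊆ ⋃ i, (α ⁻¹' {i} \ C i) := by
      intro x hx
      refine mem_iUnion.2 ⟨α x, rfl, fun h => hx (mem_iUnion.2 ⟨_, h⟩)⟩
    have h2 : ν (⋃ i, C i)ᶜ ≤ ENNReal.ofReal γ := by
      calc ν (⋃ i, C i)ᶜ ≤ ν (⋃ i, (α ⁻¹' {i} \ C i)) := measure_mono hsub
        _ ≤ ∑ i, ν (α ⁻¹' {i} \ C i) := measure_iUnion_fintype_le _ _
        _ ≤ ∑ i : Fin k, ENNReal.ofReal (γ / (k + 1)) := Finset.sum_le_sum fun i _ => (hCν i).le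
        _ = ENNReal.ofReal (k * (γ / (k + 1))) := by
          rw [Finset.sum_const, ENNReal.ofReal_mul (by positivity)]
          simp
        _ ≤ ENNReal.ofReal γ := by
          refine ENNReal.ofReal_le_ofReal ?_
          rw [← mul_div_assoc, div_le_iff₀ (by positivity)]
          nlinarith
    exact ENNReal.toReal_le_of_le_ofReal hγ.le h2
  · have h3 : ∀ᶠ δ in 𝓝[>] (0 : ℝ), ∀ i j, i ≠ j →
        Disjoint (Metric.thickening δ (C i)) (Metric.thickening δ (C j)) := by
      rw [eventually_all]; intro i
      rw [eventually_all]; intro j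
      by_cases hij : i = j
      · exact Eventually.of_forall fun δ h => absurd hij h
      · have hd : Disjoint (C i) (C j) := by
          rw [Set.disjoint_left]
          intro x hx hx'
          have e1 : α x = i := hCs i hx
          have e2 : α x = j := hCs j hx'
          exact hij (e1.symm.trans e2)
        obtain ⟨δ0, h0, hδ0⟩ := hd.exists_thickenings (hCc i).isCompact (hCc j)
        filter_upwards [Ioo_mem_nhdsGT h0] with δ hδ _
        exact hδ0.mono (Metric.thickening_mono hδ.2.le _) (Metric.thickening_mono hδ.2.le _)
    obtain ⟨δ, hδ, hδ0⟩ := (h3.and self_mem_nhdsWithin).exists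
    exact ⟨δ, hδ0, hδ⟩

lemma bowen_open (A : Finset G) (x : X) (δ : ℝ) : IsOpen (bowenBall A x δ) := by
  have : bowenBall A x δ = ⋂ g ∈ A, {y | dist (g • x) (g • y) < δ} := by
    ext y; simp [bowenBall]
  rw [this]
  refine isOpen_biInter_finset fun g _ => ?_
  exact isOpen_lt (continuous_const.dist (continuous_const_smul g)) continuous_const

lemma thmA_core (hmp : ∀ g : G, MeasurePreserving (fun x : X => g • x) ν ν)
    (herg : ErgodicMeasure G ν) (F : ℕ → Finset G) (hF : IsFolnerSeq F) (hT : IsTemperedSeq F)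
    (hG : GrowthCond F) (μ : Measure X) [IsProbabilityMeasure μ]
    (hsupp : ∀ᵐ x ∂ν, ∀ U ∈ 𝓝 x, 0 < μ U) (hα : Measurable α) (c c' : ℝ) (hcc : c < c')
    (hfreq : ∃ᶠ n in atTop, c' < partitionEntropy ν α (F n) / (F n).card) :
    ∀ᵐ x ∂ν, ENNReal.ofReal c ≤ localLowerEntropy F μ x := by
  set ε := (c' - c) / 6 with hε
  have hε0 : 0 < ε := by rw [hε]; linarith
  -- parameters
  obtain ⟨K, hK1, hK⟩ : ∃ K : ℝ, k * Real.exp (-K) ≤ ε ∧ 0 ≤ K := by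
    have h1 := Real.tendsto_exp_neg_atTop_nhds_zero.const_mul (k : ℝ)
    rw [mul_zero] at h1
    exact ((h1.eventually (ge_mem_nhds hε0)).and (eventually_ge_atTop 0)).exists
  set θ := min 1 (ε / (k + 1)) with hθ
  have hθ0 : 0 < θ := lt_min one_pos (by positivity)
  have hθ1 : θ ≤ 1 := min_le_left _ _
  have hkθ : k * θ ≤ ε := by
    have h1 : θ ≤ ε / (k + 1) := min_le_right _ _
    rw [le_div_iff₀ (by positivity)] at h1
    nlinarith
  set lam := -Real.log θ with hlam
  have hlam0 : 0 ≤ lam := by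
    have := Real.log_nonpos hθ0.le hθ1
    linarith
  have hexplam : Real.exp (-lam) = θ := by rw [hlam, neg_neg, Real.exp_log hθ0]
  set γ := ε / (lam + 1) with hγ
  have hγ0 : 0 < γ := by positivity
  have hγlam : lam * γ ≤ ε := by
    rw [hγ, ← mul_div_assoc, div_le_iff₀ (by positivity)]
    nlinarith
  obtain ⟨C, hCc, hCs, hCν, δ, hδ, hdis⟩ := good_sets (ν := ν) hα γ hγ0
  obtain ⟨J, hJ, hJK, hJint, hJprod⟩ := info_limit hmp hα F hF K hK c' hfreq
  classical
  set bad : Set X := (⋃ i, C i)ᶜ with hbad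
  have hbadm : MeasurableSet bad := (MeasurableSet.iUnion fun i => (hCc i).measurableSet).compl
  set r : Fin k → X → ℝ := fun i y => if y ∈ Metric.thickening δ (C i) then 1 else θ with hr
  have hrm : ∀ i, Measurable (r i) := fun i =>
    Measurable.ite Metric.isOpen_thickening.measurableSet measurable_const measurable_const
  have hr0 : ∀ i y, 0 ≤ r i y ∧ r i y ≤ 1 := by
    intro i y
    simp only [hr]
    split_ifs
    · exact ⟨zero_le_one, le_rfl⟩
    · exact ⟨hθ0.le, hθ1⟩
  have hθr : ∀ i y, θ ≤ r i y := by
    intro i y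
    simp only [hr]
    split_ifs
    · exact hθ1
    · exact le_rfl
  have hE : ∀ y, ∑ i, r i y ≤ Real.exp ε := by
    intro y
    have h1 : ∑ i, r i y ≤ 1 + k * θ := by
      by_cases hy : ∃ i0, y ∈ Metric.thickening δ (C i0)
      · obtain ⟨i0, hi0⟩ := hy
        calc ∑ i, r i y ≤ ∑ i, ((if i = i0 then 1 else 0) + θ) := by
              refine Finset.sum_le_sum fun i _ => ?_
              by_cases hi : i = i0
              · simp only [hi, if_true]
                linarith [(hr0 i0 y).2]
              · have : y ∉ Metric.thickening δ (C i) := fun h =>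
                  Set.disjoint_left.1 (hdis i i0 hi) h hi0
                simp [hr, hi, this]
          _ = 1 + k * θ := by
            rw [Finset.sum_add_distrib]; simp
      · push Not at hy
        calc ∑ i, r i y = ∑ i : Fin k, θ := Finset.sum_congr rfl fun i _ => by simp [hr, hy i]
          _ = k * θ := by simp
          _ ≤ 1 + k * θ := by linarith
    have h2 := Real.add_one_le_exp ε
    linarith
  set R : ℕ → X → ℝ := fun n x => ∫ y, ∏ g ∈ F n, r (α (g • x)) (g • y) ∂μ with hR
  set s : ℕ → X → ℝ := fun n x => ∑ g ∈ F n, J (g • x) with hs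
  have hsm : ∀ n, Measurable (s n) := fun n =>
    Finset.measurable_fun_sum _ fun g _ => hJ.comp (hmp g).measurable
  have hsb : ∀ n x, |s n x| ≤ (F n).card * K := by
    intro n x
    rw [abs_of_nonneg (Finset.sum_nonneg fun g _ => (hJK _).1)]
    calc s n x ≤ ∑ g ∈ F n, K := Finset.sum_le_sum fun g _ => (hJK _).2
      _ = _ := by simp
  have hfub := fun n => fubini_bound hα μ (fun g => (hmp g).measurable) (F n) r hrm hr0
    (Real.exp ε) hE (s n) (hsm n) _ (hsb n) (hJprod (F n))
  have hR0 : ∀ n x, 0 ≤ R n x := fun n x =>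
    integral_nonneg fun y => Finset.prod_nonneg fun g _ => (hr0 _ _).1
  have hev := ae_eventually_le_one (ν := ν)
    (fun n x => R n x * Real.exp (s n x) * Real.exp (-(2 * ε * (F n).card)))
    (fun n => (hfub n).1.mul_const _)
    (fun n x => mul_nonneg (mul_nonneg (hR0 n x) (Real.exp_pos _).le) (Real.exp_pos _).le)
    _ (growth_summable F hG ε hε0) (by
      intro n
      rw [integral_mul_const]
      calc _ ≤ Real.exp ε ^ (F n).card * Real.exp (-(2 * ε * (F n).card)) :=
            mul_le_mul_of_nonneg_right (hfub n).2 (Real.exp_pos _).le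
        _ = _ := by
          rw [← Real.exp_nat_mul, ← Real.exp_add]; congr 1; ring)
  have herg1 := pointwise_ergodic hmp herg F hF hT J hJ K fun x => by
    rw [abs_of_nonneg (hJK x).1]; exact (hJK x).2
  have herg2 := pointwise_ergodic hmp herg F hF hT (bad.indicator fun _ => 1)
    (measurable_const.indicator hbadm) 1 fun x => by by_cases hx : x ∈ bad <;> simp [hx]
  filter_upwards [hsupp, hev, herg1, herg2] with x hx1 hx2 hx3 hx4
  have hbadint : ∫ y, bad.indicator (fun _ => (1 : ℝ)) y ∂ν ≤ γ := by
    rw [integral_indicator hbadm]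
    simpa using hCν
  have hlower : ∀ n, Real.exp (-(lam * ∑ g ∈ F n, bad.indicator (fun _ => (1 : ℝ)) (g • x))) *
      μ.real (bowenBall (F n) x δ) ≤ R n x := by
    intro n
    have hBm := (bowen_open (F n) x δ).measurableSet
    set v := Real.exp (-(lam * ∑ g ∈ F n, bad.indicator (fun _ => (1 : ℝ)) (g • x))) with hv
    have hpm : Measurable fun y => ∏ g ∈ F n, r (α (g • x)) (g • y) :=
      Finset.measurable_fun_prod _ fun g _ => (hrm _).comp (hmp g).measurable
    calc v * μ.real (bowenBall (F n) x δ)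
        = ∫ y, (bowenBall (F n) x δ).indicator (fun _ => v) y ∂μ := by
          rw [integral_indicator hBm]; simp [mul_comm]
      _ ≤ R n x := by
        refine integral_mono ((integrable_const v).indicator hBm)
          (integrable_bdd hpm 1 fun y => ?_) fun y => ?_
        · rw [abs_of_nonneg (Finset.prod_nonneg fun g _ => (hr0 _ _).1)]
          exact Finset.prod_le_one (fun g _ => (hr0 _ _).1) fun g _ => (hr0 _ _).2
        · by_cases hy : y ∈ bowenBall (F n) x δ
          · rw [indicator_of_mem hy, hv, Finset.mul_sum, ← Finset.sum_neg_distrib, Real.exp_sum]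
            refine Finset.prod_le_prod (fun g _ => (Real.exp_pos _).le) fun g hg => ?_
            by_cases hgb : g • x ∈ bad
            · rw [indicator_of_mem hgb, mul_one, hexplam]
              exact hθr _ _
            · rw [indicator_of_notMem hgb]
              have h1 : g • x ∈ ⋃ i, C i := by simpa [hbad] using hgb
              obtain ⟨i, hi⟩ := mem_iUnion.1 h1
              have h2 : α (g • x) = i := hCs i hi
              have h3 : g • y ∈ Metric.thickening δ (C i) := by
                rw [Metric.mem_thickening_iff]
                refine ⟨g • x, hi, ?_⟩
                rw [dist_comm]; exact hy g hg
              simp [hr, h2, h3]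
          · rw [indicator_of_notMem hy]
            exact Finset.prod_nonneg fun g _ => (hr0 _ _).1
  have hfinal : ∀ᶠ n in atTop, c ≤ -(Real.log (μ (bowenBall (F n) x δ)).toReal) / (F n).card := by
    have hlim := hx3.sub (hx4.const_mul lam)
    have hlt : c + 2 * ε < ∫ y, J y ∂ν - lam * ∫ y, bad.indicator (fun _ => (1 : ℝ)) y ∂ν := by
      have := mul_le_mul_of_nonneg_left hbadint hlam0
      have : c' = c + 6 * ε := by rw [hε]; ring
      linarith
    filter_upwards [hx2, hlim.eventually (lt_mem_nhds hlt)] with n hn1 hn2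
    have hc : (0 : ℝ) < (F n).card := by exact_mod_cast (hF.1 n).card_pos
    have hpos : 0 < μ.real (bowenBall (F n) x δ) := by
      refine ENNReal.toReal_pos (hx1 _ ?_).ne' (measure_ne_top _ _)
      exact (bowen_open (F n) x δ).mem_nhds fun g _ => by simpa using hδ
    set N := ∑ g ∈ F n, bad.indicator (fun _ => (1 : ℝ)) (g • x) with hN
    have h1 : Real.exp (-(lam * N)) * μ.real (bowenBall (F n) x δ) * Real.exp (s n x) *
        Real.exp (-(2 * ε * (F n).card)) ≤ 1 := by
      refine le_trans ?_ hn1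
      exact mul_le_mul_of_nonneg_right (mul_le_mul_of_nonneg_right (hlower n) (Real.exp_pos _).le)
        (Real.exp_pos _).le
    have h2 : Real.log (μ.real (bowenBall (F n) x δ)) ≤ lam * N - s n x + 2 * ε * (F n).card := by
      rw [Real.log_le_iff_le_exp hpos]
      have e : Real.exp (-(lam * N)) * μ.real (bowenBall (F n) x δ) * Real.exp (s n x) *
        Real.exp (-(2 * ε * (F n).card)) = μ.real (bowenBall (F n) x δ) *
          Real.exp (-(lam * N - s n x + 2 * ε * (F n).card)) := by
        have : -(lam * N - s n x + 2 * ε * (F n).card) =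
          -(lam * N) + s n x + -(2 * ε * (F n).card) := by ring
        rw [this, Real.exp_add, Real.exp_add]; ring
      rw [e, Real.exp_neg, ← div_eq_mul_inv, div_le_one (Real.exp_pos _)] at h1
      exact h1
    have h3 : avgF F n J x - lam * avgF F n (bad.indicator fun _ => 1) x =
        (s n x - lam * N) / (F n).card := by
      unfold avgF
      simp only [hs, hN]
      ring
    rw [h3, lt_div_iff₀ hc] at hn2
    rw [le_div_iff₀ hc]
    rw [measureReal_def] at h2
    linarith
  refine le_trans ?_ (le_iSup₂_of_le δ hδ le_rfl)
  refine le_liminf_of_le (by isBoundedDefault) ?_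
  filter_upwards [hfinal] with n hn
  exact ENNReal.ofReal_le_ofReal hn

end TheoremA2

section EntropyCont

set_option linter.unusedSectionVars false

variable {G : Type*} [Group G] [DecidableEq G] {X : Type*} [MeasurableSpace X] [MulAction G X]
  {k : ℕ} {ν : Measure X} [IsProbabilityMeasure ν] {α β : X → Fin k}

/-- edit weight -/
noncomputable def tau (θ : ℝ) (i j : Fin k) : ℝ := if i = j then 1 else θ

lemma tau_pos {θ : ℝ} (hθ : 0 < θ) (i j : Fin k) : 0 < tau θ i j := by
  unfold tau; split_ifs
  · exact one_pos
  · exact hθ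

lemma sum_tau {θ : ℝ} (hθ : 0 < θ) (j : Fin k) : ∑ i, tau θ i j ≤ 1 + k * θ := by
  calc ∑ i, tau θ i j ≤ ∑ i, ((if i = j then 1 else 0) + θ) := by
        refine Finset.sum_le_sum fun i _ => ?_
        unfold tau; split_ifs <;> linarith
    _ = 1 + k * θ := by rw [Finset.sum_add_distrib]; simp

lemma entropy_ratio (hmp : ∀ g : G, MeasurePreserving (fun x : X => g • x) ν ν)
    (hα : Measurable α) (hβ : Measurable β) (S : Finset G) (θ : ℝ) (hθ : 0 < θ) :
    Integrable (fun x => mm ν β S x * (∏ g : ↥S, tau θ (nm α S x g) (nm β S x g)) / mm ν α S x) ν ∧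
    ∫ x, mm ν β S x * (∏ g : ↥S, tau θ (nm α S x g) (nm β S x g)) / mm ν α S x ∂ν ≤
      (1 + k * θ) ^ S.card := by
  have hTa := measurable_nm hmp hα S
  have hTb := measurable_nm hmp hβ S
  have h := integral_comp_fin (ν := ν) (fun x => (nm α S x, nm β S x)) (hTa.prodMk hTb)
    (fun z => ν.real {y | nm β S y = z.2} * (∏ g : ↥S, tau θ (z.1 g) (z.2 g)) /
      ν.real {y | nm α S y = z.1})
  refine ⟨h.1, ?_⟩
  have h2 := h.2
  unfold mm
  simp only at h2
  rw [h2, Fintype.sum_prod_type, Finset.sum_comm]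
  have hone : ∑ w' : ↥S → Fin k, ν.real {y | nm β S y = w'} = 1 := by
    have := (integral_comp_fin (ν := ν) (nm β S) hTb (fun _ => 1)).2
    simpa using this.symm
  calc _ ≤ ∑ w' : ↥S → Fin k, ν.real {y | nm β S y = w'} * (1 + k * θ) ^ S.card := by
        refine Finset.sum_le_sum fun w' _ => ?_
        calc _ ≤ ∑ w : ↥S → Fin k, ν.real {y | nm β S y = w'} *
              ∏ g : ↥S, tau θ (w g) (w' g) := by
              refine Finset.sum_le_sum fun w _ => ?_
              set b := ν.real {y | nm β S y = w'}
              set a := ν.real {y | nm α S y = w} with ha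
              set c := ν.real {y | (nm α S y, nm β S y) = (w, w')} with hc
              have hca : c ≤ a := by
                refine measureReal_mono (fun y hy => ?_) (measure_ne_top _ _)
                simp only [mem_ofPred_eq, Prod.mk.injEq] at hy
                exact hy.1
              have hc0 : 0 ≤ c := measureReal_nonneg
              have hbp : 0 ≤ b * ∏ g : ↥S, tau θ (w g) (w' g) :=
                mul_nonneg measureReal_nonneg (Finset.prod_nonneg fun g _ => (tau_pos hθ _ _).le)
              rcases (hc0.trans hca).eq_or_lt with h0 | h0
              · rw [← h0, div_zero, mul_zero]; exact hbp
              · rw [← mul_div_assoc, div_le_iff₀ h0, mul_comm c]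
                exact mul_le_mul_of_nonneg_left hca hbp
          _ = ν.real {y | nm β S y = w'} * ∏ g : ↥S, ∑ i, tau θ i (w' g) := by
              rw [← Finset.mul_sum, Finset.prod_univ_sum, Fintype.piFinset_univ]
          _ ≤ _ := by
              refine mul_le_mul_of_nonneg_left ?_ measureReal_nonneg
              calc _ ≤ ∏ g : ↥S, (1 + k * θ) :=
                    Finset.prod_le_prod (fun g _ => Finset.sum_nonneg fun i _ => (tau_pos hθ _ _).le)
                      fun g _ => sum_tau hθ _
                _ = _ := by simp
    _ = _ := by rw [← Finset.sum_mul, hone, one_mul]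

lemma entropy_cont (hmp : ∀ g : G, MeasurePreserving (fun x : X => g • x) ν ν)
    (hα : Measurable α) (hβ : Measurable β) (S : Finset G) (θ : ℝ) (hθ : 0 < θ) :
    partitionEntropy ν α S ≤ partitionEntropy ν β S +
      S.card * (-Real.log θ * ν.real {x | α x ≠ β x} + Real.log (1 + k * θ)) := by
  rw [partitionEntropy_eq hmp hα, partitionEntropy_eq hmp hβ]
  obtain ⟨i1, i2⟩ := entropy_ratio hmp hα hβ S θ hθ
  set D : Set X := {x | α x ≠ β x} with hD
  have hDm : MeasurableSet D := (measurableSet_eq_fun hα hβ).compl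
  have hE : 0 < (1 + k * θ) ^ S.card := by positivity
  have iL : ∀ (α : X → Fin k), Measurable α →
      Integrable (fun x => -Real.log (mm ν α S x)) ν := fun α hα =>
    (meas_of_nm hmp hα S _ fun x y h => by rw [mm_congr subset_rfl h]).2
  have iD : ∀ g : G, Integrable (fun x => D.indicator (fun _ => (1 : ℝ)) (g • x)) ν := by
    intro g
    refine integrable_bdd ((measurable_const.indicator hDm).comp (hmp g).measurable) 1 fun x => ?_
    by_cases h : g • x ∈ D <;> simp [h]
  have key : ∫ x, (-Real.log (mm ν α S x)) ∂ν ≤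
      ∫ x, (-Real.log (mm ν β S x) +
        (-Real.log θ * ∑ g ∈ S, D.indicator (fun _ => (1 : ℝ)) (g • x)) +
        (S.card * Real.log (1 + k * θ) - 1) +
        (mm ν β S x * (∏ g : ↥S, tau θ (nm α S x g) (nm β S x g)) / mm ν α S x) /
          (1 + k * θ) ^ S.card) ∂ν := by
    refine integral_mono_ae (iL α hα) ((((iL β hβ).add
      ((integrable_finsetSum _ fun g _ => iD g).const_mul _)).add (integrable_const _)).add
      (i1.div_const _)) ?_
    filter_upwards [mm_pos hmp hα S, mm_pos hmp hβ S] with x ha hb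
    have hp : 0 < ∏ g : ↥S, tau θ (nm α S x g) (nm β S x g) :=
      Finset.prod_pos fun g _ => tau_pos hθ _ _
    have h1 := Real.log_le_sub_one_of_pos (div_pos (div_pos (mul_pos hb hp) ha) hE)
    rw [Real.log_div (div_pos (mul_pos hb hp) ha).ne' hE.ne',
      Real.log_div (mul_pos hb hp).ne' ha.ne', Real.log_mul hb.ne' hp.ne', Real.log_pow,
      Real.log_prod (fun g _ => (tau_pos hθ _ _).ne')] at h1
    have h2 : ∑ g : ↥S, Real.log (tau θ (nm α S x g) (nm β S x g)) =
        Real.log θ * ∑ g ∈ S, D.indicator (fun _ => (1 : ℝ)) (g • x) := by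
      rw [← Finset.sum_coe_sort S, Finset.mul_sum]
      refine Finset.sum_congr rfl fun g _ => ?_
      unfold tau nm
      by_cases h : α ((g : G) • x) = β ((g : G) • x)
      · have : (g : G) • x ∉ D := fun h' => h' h
        simp [h, this]
      · have : (g : G) • x ∈ D := h
        simp [h, this]
    rw [h2] at h1
    linarith
  refine key.trans ?_
  have j1 : Integrable (fun x => -Real.log θ *
      ∑ g ∈ S, D.indicator (fun _ => (1 : ℝ)) (g • x)) ν :=
    (integrable_finsetSum _ fun g _ => iD g).const_mul _
  have j2 : Integrable (fun x => -Real.log (mm ν β S x) + -Real.log θ *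
      ∑ g ∈ S, D.indicator (fun _ => (1 : ℝ)) (g • x)) ν := (iL β hβ).add j1
  have j3 : Integrable (fun x => -Real.log (mm ν β S x) + -Real.log θ *
      ∑ g ∈ S, D.indicator (fun _ => (1 : ℝ)) (g • x) +
        (S.card * Real.log (1 + k * θ) - 1)) ν := j2.add (integrable_const _)
  rw [integral_add j3 (i1.div_const _), integral_add j2 (integrable_const _),
    integral_add (iL β hβ) j1, integral_const_mul, integral_finsetSum _ fun g _ => iD g,
    integral_div]
  have e : ∀ g ∈ S, ∫ x, D.indicator (fun _ => (1 : ℝ)) (g • x) ∂ν = ν.real D := by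
    intro g _
    rw [integral_smul_eq' hmp g _ (measurable_const.indicator hDm).aestronglyMeasurable,
      integral_indicator hDm]
    simp
  rw [Finset.sum_congr rfl e, Finset.sum_const, nsmul_eq_mul]
  have h5 := (div_le_one hE).2 i2
  simp only [integral_const, probReal_univ, smul_eq_mul, one_mul]
  linarith

/-- decoding -/
noncomputable def decFn (k : ℕ) (t : Fin (k + 1) → Prop) : Fin (k + 1) := by
  classical
  exact if h : ∃ i, t = fun j => j = i then h.choose else 0

lemma decFn_eq (k : ℕ) (i : Fin (k + 1)) : decFn k (fun j => j = i) = i := by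
  classical
  have h : ∃ i', (fun j => j = i) = fun j : Fin (k + 1) => j = i' := ⟨i, rfl⟩
  unfold decFn
  rw [dif_pos h]
  have := congrFun h.choose_spec h.choose
  simpa using this

/-- partition coded by a family of sets -/
noncomputable def codeP {k : ℕ} (A : Fin (k + 1) → Set X) (x : X) : Fin (k + 1) :=
  decFn k (fun j => x ∈ A j)

lemma codeP_meas {k : ℕ} (A : Fin (k + 1) → Set X) (hA : ∀ i, MeasurableSet (A i)) :
    Measurable (codeP A) := by
  have h1 : Measurable fun x => (fun j => x ∈ A j : Fin (k + 1) → Prop) :=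
    measurable_pi_lambda _ fun j => measurableSet_setOfPred.1 (hA j)
  exact (measurable_of_finite (decFn k)).comp h1

lemma codeP_ne {k : ℕ} (A : Fin (k + 1) → Set X) (α : X → Fin (k + 1)) :
    {x | α x ≠ codeP A x} ⊆ ⋃ i, symmDiff (α ⁻¹' {i}) (A i) := by
  intro x hx
  by_contra h
  apply hx
  have h1 : (fun j => x ∈ A j) = fun j => j = α x := by
    ext j
    have hj : x ∉ symmDiff (α ⁻¹' {j}) (A j) := fun h' => h (mem_iUnion.2 ⟨j, h'⟩)
    rw [Set.mem_symmDiff] at hj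
    simp only [mem_preimage, mem_singleton_iff] at hj
    constructor
    · intro hm
      by_contra hne
      exact hj (Or.inr ⟨hm, fun h => hne h.symm⟩)
    · intro he
      by_contra hne
      exact hj (Or.inl ⟨he.symm, hne⟩)
  unfold codeP
  rw [h1, decFn_eq]

end EntropyCont

section Countable

set_option linter.unusedSectionVars false

variable {G : Type*} [Group G] [DecidableEq G] {X : Type*} [MeasurableSpace X] [MulAction G X]

lemma exists_small_theta (k : ℕ) (κ : ℝ) (hκ : 0 < κ) :
    ∃ θ : ℝ, 0 < θ ∧ Real.log (1 + k * θ) ≤ κ := by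
  refine ⟨κ / (k + 1), by positivity, ?_⟩
  have h1 : (0 : ℝ) < 1 + k * (κ / (k + 1)) := by positivity
  have h2 := Real.log_le_sub_one_of_pos h1
  have h3 : (k : ℝ) * (κ / (k + 1)) ≤ κ := by
    rw [mul_div_assoc', div_le_iff₀ (by positivity)]
    nlinarith
  linarith

lemma approx_partition {k : ℕ} {ν : Measure X} [IsProbabilityMeasure ν]
    {𝒜 : Set (Set X)} (h𝒜 : ν.MeasureDense 𝒜)
    (α : X → Fin (k + 1)) (hα : Measurable α) (γ : ℝ) (hγ : 0 < γ) :
    ∃ A : Fin (k + 1) → 𝒜, ν.real {x | α x ≠ codeP (fun i => (A i : Set X)) x} ≤ γ := by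
  have h1 : ∀ i, ∃ A : 𝒜, ν (symmDiff (α ⁻¹' {i}) A) < ENNReal.ofReal (γ / (k + 1)) := by
    intro i
    obtain ⟨t, ht, ht'⟩ := h𝒜.approx (α ⁻¹' {i}) (hα (measurableSet_singleton i))
      (measure_ne_top _ _) (γ / (k + 1)) (by positivity)
    exact ⟨⟨t, ht⟩, ht'⟩
  choose A hA using h1
  refine ⟨A, ?_⟩
  calc ν.real {x | α x ≠ codeP (fun i => (A i : Set X)) x}
      ≤ ν.real (⋃ i, symmDiff (α ⁻¹' {i}) (A i)) :=
        measureReal_mono (codeP_ne (fun i => (A i : Set X)) α)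
    _ ≤ ∑ i, ν.real (symmDiff (α ⁻¹' {i}) (A i)) := measureReal_iUnion_fintype_le _
    _ ≤ ∑ _i : Fin (k + 1), γ / (k + 1) := by
        refine Finset.sum_le_sum fun i _ => ?_
        exact ENNReal.toReal_le_of_le_ofReal (by positivity) (hA i).le
    _ = γ := by
        simp only [Finset.sum_const, Finset.card_univ, Fintype.card_fin, nsmul_eq_mul]
        push_cast
        field_simp

lemma limsup_entropy_approx {k : ℕ} {ν : Measure X} [IsProbabilityMeasure ν]
    (hmp : ∀ g : G, MeasurePreserving (fun x : X => g • x) ν ν)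
    (F : ℕ → Finset G) (hF : IsFolnerSeq F)
    {𝒜 : Set (Set X)} (h𝒜 : ν.MeasureDense 𝒜)
    (α : X → Fin (k + 1)) (hα : Measurable α) (κ : ℝ≥0) (hκ : 0 < κ) :
    ∃ A : Fin (k + 1) → 𝒜,
      limsup (fun n => ENNReal.ofReal (partitionEntropy ν α (F n) / (F n).card)) atTop ≤
      limsup (fun n => ENNReal.ofReal (partitionEntropy ν (codeP (fun i => (A i : Set X))) (F n)
        / (F n).card)) atTop + κ := by
  have hκ' : (0 : ℝ) < κ := hκ
  obtain ⟨θ, hθ, hθ'⟩ := exists_small_theta (k + 1) (κ / 2) (by positivity)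
  obtain ⟨A, hA⟩ := approx_partition h𝒜 α hα ((κ / 2) / (|Real.log θ| + 1)) (by positivity)
  refine ⟨A, ?_⟩
  have hβ : Measurable (codeP (fun i => (A i : Set X))) :=
    codeP_meas _ fun i => h𝒜.measurable _ (A i).2
  rw [← limsup_add_const atTop _ _ (by isBoundedDefault) (by isBoundedDefault)]
  refine limsup_le_limsup (Eventually.of_forall fun n => ?_)
  have hc : (0 : ℝ) < (F n).card := by exact_mod_cast (hF.1 n).card_pos
  have h1 := entropy_cont hmp hα hβ (F n) θ hθ
  have h2 : -Real.log θ * ν.real {x | α x ≠ codeP (fun i => (A i : Set X)) x} ≤ κ / 2 := by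
    have h3 : -Real.log θ ≤ |Real.log θ| + 1 := by
      have := neg_abs_le (Real.log θ); linarith
    calc _ ≤ (|Real.log θ| + 1) * ν.real {x | α x ≠ codeP (fun i => (A i : Set X)) x} :=
          mul_le_mul_of_nonneg_right h3 measureReal_nonneg
      _ ≤ (|Real.log θ| + 1) * ((κ / 2) / (|Real.log θ| + 1)) :=
          mul_le_mul_of_nonneg_left hA (by positivity)
      _ = κ / 2 := by field_simp
  have h3 : partitionEntropy ν α (F n) / (F n).card ≤
      partitionEntropy ν (codeP (fun i => (A i : Set X))) (F n) / (F n).card + κ := by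
    rw [div_le_iff₀ hc, add_mul, div_mul_cancel₀ _ hc.ne']
    have h4 := mul_le_mul_of_nonneg_left (add_le_add h2 hθ') hc.le
    nlinarith
  calc ENNReal.ofReal (partitionEntropy ν α (F n) / (F n).card) ≤ _ :=
        ENNReal.ofReal_le_ofReal h3
    _ ≤ _ := ENNReal.ofReal_add_le
    _ = _ := by rw [ENNReal.ofReal_coe_nnreal]

lemma exists_countable_family [MeasurableSpace.CountablyGenerated X] (F : ℕ → Finset G)
    (hF : IsFolnerSeq F) :
    ∃ (kk : ℕ → ℕ) (β : ∀ j, X → Fin (kk j)), (∀ j, Measurable (β j)) ∧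
      ∀ ν : Measure X, IsProbabilityMeasure ν →
        (∀ g : G, MeasurePreserving (fun x : X => g • x) ν ν) →
        measEntropy F ν = ⨆ j, limsup (fun n =>
          ENNReal.ofReal (partitionEntropy ν (β j) (F n) / (F n).card)) atTop := by
  set 𝒜 : Set (Set X) := generateSetAlgebra (MeasurableSpace.countableGeneratingSet X) with h𝒜
  have hcount : 𝒜.Countable :=
    countable_generateSetAlgebra (MeasurableSpace.countable_countableGeneratingSet)
  have hgen : ‹MeasurableSpace X› = MeasurableSpace.generateFrom 𝒜 := by
    rw [h𝒜, generateFrom_generateSetAlgebra_eq,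
      MeasurableSpace.generateFrom_countableGeneratingSet]
  have hc𝒜 : Countable 𝒜 := hcount
  have hne : Nonempty (Σ k : ℕ, (Fin (k + 1) → 𝒜)) :=
    ⟨⟨0, fun _ => ⟨∅, isSetAlgebra_generateSetAlgebra.empty_mem⟩⟩⟩
  obtain ⟨e, he⟩ := exists_surjective_nat (Σ k : ℕ, (Fin (k + 1) → 𝒜))
  have hmeas : ∀ s ∈ 𝒜, MeasurableSet s := fun s hs => by
    rw [hgen]; exact MeasurableSpace.measurableSet_generateFrom hs
  have hβm : ∀ j, Measurable (codeP (fun i => ((e j).2 i : Set X))) :=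
    fun j => codeP_meas _ fun i => hmeas _ ((e j).2 i).2
  refine ⟨fun j => (e j).1 + 1, fun j => codeP (fun i => ((e j).2 i : Set X)), hβm, ?_⟩
  intro ν hν hmp
  have hd : ν.MeasureDense 𝒜 :=
    Measure.MeasureDense.of_generateFrom_isSetAlgebra_finite ν isSetAlgebra_generateSetAlgebra hgen
  apply le_antisymm
  · refine iSup_le fun k => iSup_le fun α => iSup_le fun hα => ?_
    obtain ⟨x⟩ : Nonempty X := nonempty_of_isProbabilityMeasure ν
    cases k with
    | zero => exact (α x).elim0
    | succ k =>
      refine ENNReal.le_of_forall_pos_le_add fun κ hκ _ => ?_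
      obtain ⟨A, hA⟩ := limsup_entropy_approx hmp F hF hd α hα κ hκ
      refine hA.trans (add_le_add ?_ le_rfl)
      obtain ⟨j, hj⟩ := he ⟨k, A⟩
      refine le_trans ?_ (le_iSup _ j)
      let Φ : (Σ k : ℕ, (Fin (k + 1) → 𝒜)) → ℝ≥0∞ := fun s => limsup (fun n =>
        ENNReal.ofReal (partitionEntropy ν (codeP (fun i => (s.2 i : Set X))) (F n)
          / (F n).card)) atTop
      change Φ ⟨k, A⟩ ≤ Φ (e j)
      rw [hj]
  · refine iSup_le fun j => ?_
    exact le_iSup_of_le _ (le_iSup_of_le _ (le_iSup_of_le (hβm j) le_rfl))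

end Countable

section TheoremA3

set_option linter.unusedSectionVars false

variable {G : Type*} [Group G] [DecidableEq G] {X : Type*} [MetricSpace X] [CompactSpace X]
  [MulAction G X] [ContinuousConstSMul G X] [MeasurableSpace X] [BorelSpace X]

lemma thmA_part {ν : Measure X} [IsProbabilityMeasure ν] {k : ℕ} {α : X → Fin k}
    (hmp : ∀ g : G, MeasurePreserving (fun x : X => g • x) ν ν)
    (herg : ErgodicMeasure G ν) (F : ℕ → Finset G) (hF : IsFolnerSeq F) (hT : IsTemperedSeq F)
    (hG : GrowthCond F) (μ : Measure X) [IsProbabilityMeasure μ]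
    (hsupp : ∀ᵐ x ∂ν, ∀ U ∈ 𝓝 x, 0 < μ U) (hα : Measurable α) :
    ∀ᵐ x ∂ν, limsup (fun n => ENNReal.ofReal (partitionEntropy ν α (F n) / (F n).card)) atTop
      ≤ localLowerEntropy F μ x := by
  set L := limsup (fun n => ENNReal.ofReal (partitionEntropy ν α (F n) / (F n).card)) atTop
    with hL
  have h1 : ∀ q : ℚ, ∀ᵐ x ∂ν, ENNReal.ofReal q < L → ENNReal.ofReal q ≤ localLowerEntropy F μ x := by
    intro q
    by_cases hq : ENNReal.ofReal q < L
    · by_cases hq0 : (0 : ℝ) ≤ q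
      · obtain ⟨r, -, hr1, hr2⟩ := ENNReal.lt_iff_exists_real_btwn.1 hq
        have hfr := frequently_lt_of_lt_limsup (by isBoundedDefault) hr2
        have hqr : (q : ℝ) < r := by
          rw [ENNReal.ofReal_lt_ofReal_iff'] at hr1
          exact hr1.1
        have := thmA_core hmp herg F hF hT hG μ hsupp hα q r hqr
          (hfr.mono fun n hn => (ENNReal.ofReal_lt_ofReal_iff'.1 hn).1)
        filter_upwards [this] with x hx _ using hx
      · filter_upwards with x _
        rw [ENNReal.ofReal_of_nonpos (by linarith)]
        exact zero_le
    · filter_upwards with x h using absurd h hq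
  rw [← ae_all_iff] at h1
  filter_upwards [h1] with x hx
  refine le_of_forall_lt fun c hc => ?_
  obtain ⟨q, hq0, hq1, hq2⟩ := ENNReal.lt_iff_exists_rat_btwn.1 hc
  exact hq1.trans_le (hx q hq2)

lemma thmA {ν : Measure X} [IsProbabilityMeasure ν]
    (hmp : ∀ g : G, MeasurePreserving (fun x : X => g • x) ν ν)
    (herg : ErgodicMeasure G ν) (F : ℕ → Finset G) (hF : IsFolnerSeq F) (hT : IsTemperedSeq F)
    (hG : GrowthCond F) (μ : Measure X) [IsProbabilityMeasure μ]
    (hsupp : ∀ᵐ x ∂ν, ∀ U ∈ 𝓝 x, 0 < μ U) :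
    ∀ᵐ x ∂ν, measEntropy F ν ≤ localLowerEntropy F μ x := by
  obtain ⟨kk, β, hβ, hent⟩ := exists_countable_family (X := X) F hF
  have h1 : ∀ᵐ x ∂ν, ∀ j, limsup (fun n =>
      ENNReal.ofReal (partitionEntropy ν (β j) (F n) / (F n).card)) atTop
      ≤ localLowerEntropy F μ x :=
    ae_all_iff.2 fun j => thmA_part hmp herg F hF hT hG μ hsupp (hβ j)
  filter_upwards [h1] with x hx
  rw [hent ν inferInstance hmp]
  exact iSup_le hx

end TheoremA3

section Final

set_option linter.unusedSectionVars false

lemma aemeasurable_of_lintegral_add {Y : Type*} [MeasurableSpace Y] (π : Measure Y)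
    [IsProbabilityMeasure π] (f g : Y → ℝ≥0∞) (hfg : ∀ y, f y + g y = 1)
    (hintg : ∫⁻ y, f y ∂π + ∫⁻ y, g y ∂π = 1) : AEMeasurable f π := by
  obtain ⟨f0, hf0, hf1, hf2⟩ := exists_measurable_le_lintegral_eq π f
  obtain ⟨g0, hg0, hg1, hg2⟩ := exists_measurable_le_lintegral_eq π g
  have hle : ∀ y, f0 y + g0 y ≤ 1 := fun y => by
    rw [← hfg y]; exact add_le_add (hf1 y) (hg1 y)
  have h1 : (fun y => f0 y + g0 y) =ᵐ[π] fun _ => (1 : ℝ≥0∞) := by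
    refine ae_eq_of_ae_le_of_lintegral_le (Eventually.of_forall hle) ?_ aemeasurable_const ?_
    · rw [lintegral_add_left hf0, ← hf2, ← hg2, hintg]; exact ENNReal.one_ne_top
    · rw [lintegral_add_left hf0, ← hf2, ← hg2, hintg]; simp
  refine ⟨f0, hf0, ?_⟩
  filter_upwards [h1] with y hy
  refine le_antisymm ?_ (hf1 y)
  have h2 : f y + g0 y ≤ f0 y + g0 y := by
    rw [hy, ← hfg y]; exact add_le_add le_rfl (hg1 y)
  have h3 : g0 y ≠ ⊤ := ne_top_of_le_ne_top ENNReal.one_ne_top (le_add_self.trans (hle y))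
  exact (ENNReal.add_le_add_iff_right h3).1 h2

variable {G : Type*} [Group G] [DecidableEq G] {X : Type*} [MetricSpace X] [CompactSpace X]
  [MulAction G X] [ContinuousConstSMul G X] [MeasurableSpace X] [BorelSpace X]

/-- countable version of the local lower entropy -/
noncomputable def lleC (F : ℕ → Finset G) (μ : Measure X) (x : X) : ℝ≥0∞ :=
  ⨆ (m : ℕ), liminf (fun n =>
      ENNReal.ofReal (-(Real.log ((μ (bowenBall (F n) x (1 / ((m : ℝ) + 1)))).toReal))
        / (F n).card)) atTop

lemma lleC_le (F : ℕ → Finset G) (μ : Measure X) (x : X) :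
    lleC F μ x ≤ localLowerEntropy F μ x :=
  iSup_le fun m => le_iSup_of_le (1 / ((m : ℝ) + 1)) (le_iSup_of_le (by positivity) le_rfl)

lemma le_lleC (F : ℕ → Finset G) (μ : Measure X) [IsProbabilityMeasure μ] (x : X)
    (hx : ∀ U ∈ 𝓝 x, 0 < μ U) : localLowerEntropy F μ x ≤ lleC F μ x := by
  refine iSup_le fun δ => iSup_le fun hδ => ?_
  obtain ⟨m, hm⟩ := exists_nat_one_div_lt hδ
  refine le_iSup_of_le m (liminf_le_liminf (Eventually.of_forall fun n => ?_))
  refine ENNReal.ofReal_le_ofReal (div_le_div_of_nonneg_right ?_ (Nat.cast_nonneg _))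
  have hpos : 0 < (μ (bowenBall (F n) x (1 / ((m : ℝ) + 1)))).toReal := by
    refine ENNReal.toReal_pos (hx _ ?_).ne' (measure_ne_top _ _)
    refine (bowen_open (F n) x _).mem_nhds fun g _ => ?_
    rw [dist_self]; positivity
  refine neg_le_neg (Real.log_le_log hpos (ENNReal.toReal_mono (measure_ne_top _ _)
    (measure_mono fun y hy g hg => (hy g hg).trans hm)))

lemma lleC_meas (F : ℕ → Finset G) (μ : Measure X) [IsProbabilityMeasure μ] :
    Measurable (lleC F μ) := by
  refine Measurable.iSup fun m => Measurable.liminf fun n => ?_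
  refine ENNReal.measurable_ofReal.comp (Measurable.div_const (Measurable.neg ?_) _)
  refine Real.measurable_log.comp (ENNReal.measurable_toReal.comp ?_)
  have ho : IsOpen {q : X × X | ∀ g ∈ F n, dist (g • q.1) (g • q.2) < 1 / ((m : ℝ) + 1)} := by
    have : {q : X × X | ∀ g ∈ F n, dist (g • q.1) (g • q.2) < 1 / ((m : ℝ) + 1)} =
        ⋂ g ∈ F n, {q : X × X | dist (g • q.1) (g • q.2) < 1 / ((m : ℝ) + 1)} := by
      ext q; simp
    rw [this]
    refine isOpen_biInter_finset fun g _ => isOpen_lt ?_ continuous_const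
    exact ((continuous_const_smul g).comp continuous_fst).dist
      ((continuous_const_smul g).comp continuous_snd)
  exact measurable_measure_prodMk_left ho.measurableSet

lemma measEntropy_aemeas {Y : Type*} [MeasurableSpace Y] (π : Measure Y)
    (F : ℕ → Finset G) (hF : IsFolnerSeq F)
    (μy : Y → Measure X) (hprob : ∀ y, IsProbabilityMeasure (μy y))
    (hmeas : ∀ A : Set X, MeasurableSet A → AEMeasurable (fun y => μy y A) π)
    (hmp : ∀ᵐ y ∂π, ∀ g : G, MeasurePreserving (fun x : X => g • x) (μy y) (μy y)) :
    AEMeasurable (fun y => measEntropy F (μy y)) π := by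
  obtain ⟨kk, β, hβ, hent⟩ := exists_countable_family (X := X) F hF
  have h1 : AEMeasurable (fun y => ⨆ j, limsup (fun n =>
      ENNReal.ofReal (partitionEntropy (μy y) (β j) (F n) / (F n).card)) atTop) π := by
    refine AEMeasurable.iSup fun j => ?_
    simp only [limsup_eq_iInf_iSup_of_nat]
    refine AEMeasurable.iInf fun i => AEMeasurable.iSup fun n => AEMeasurable.iSup fun _ => ?_
    refine ENNReal.measurable_ofReal.comp_aemeasurable (AEMeasurable.div_const ?_ _)
    unfold partitionEntropy
    refine Finset.aemeasurable_fun_sum _ fun f _ => ?_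
    refine Real.continuous_negMulLog.measurable.comp_aemeasurable
      (ENNReal.measurable_toReal.comp_aemeasurable (hmeas _ ?_))
    have : {x : X | ∀ g : ↥(F n), β j ((g : G) • x) = f g} =
        ⋂ g : ↥(F n), (fun x => β j ((g : G) • x)) ⁻¹' {f g} := by
      ext x; simp
    rw [this]
    exact MeasurableSet.iInter fun g =>
      ((hβ j).comp (continuous_const_smul (g : G)).measurable) (measurableSet_singleton _)
  refine h1.congr ?_
  filter_upwards [hmp] with y hy
  exact (hent (μy y) (hprob y) hy).symm

end Final
variable {G : Type*} [Group G] [Countable G] [Infinite G] [DecidableEq G]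
  {X : Type*} [MetricSpace X] [CompactSpace X] [MulAction G X] [ContinuousConstSMul G X]
  [MeasurableSpace X] [BorelSpace X]

theorem lintegral_localLowerEntropy_ge
    (F : ℕ → Finset G) (hFol : IsFolnerSeq F) (hTemp : IsTemperedSeq F) (hGrow : GrowthCond F)
    (μ : Measure X) [IsProbabilityMeasure μ] (hinv : InvariantMeasure G μ)
    {Y : Type*} [MeasurableSpace Y] [MeasurableSingletonClass Y]
    (π : Measure Y) [IsProbabilityMeasure π] (p : X → Y) (hp : Measurable p)
    (μy : Y → Measure X) (hprob : ∀ y, IsProbabilityMeasure (μy y))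
    (hdecomp : ∀ A : Set X, MeasurableSet A → μ A = ∫⁻ y, μy y A ∂π)
    (hfiber : ∀ᵐ y ∂π, μy y (p ⁻¹' {y}) = 1)
    (hinv' : ∀ᵐ y ∂π, InvariantMeasure G (μy y))
    (herg : ∀ᵐ y ∂π, ErgodicMeasure G (μy y))
    (hpinv : ∀ᵐ x ∂μ, ∀ g : G, p (g • x) = p x)
    (M : ℝ) (hM : 0 < M) :
    ∫⁻ y in {y | measEntropy F (μy y) < ENNReal.ofReal M}, measEntropy F (μy y) ∂π ≤
      ∫⁻ x in {x | measEntropy F (μy (p x)) < ENNReal.ofReal M},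
        localLowerEntropy F μ x ∂μ := by
  have hmeas : ∀ A : Set X, MeasurableSet A → AEMeasurable (fun y => μy y A) π := by
    intro A hA
    refine aemeasurable_of_lintegral_add π _ (fun y => μy y Aᶜ) (fun y => ?_) ?_
    · have := hprob y
      rw [measure_add_measure_compl hA, measure_univ]
    · rw [← hdecomp A hA, ← hdecomp _ hA.compl, measure_add_measure_compl hA, measure_univ]
  have hmp : ∀ᵐ y ∂π, ∀ g : G, MeasurePreserving (fun x : X => g • x) (μy y) (μy y) := by
    filter_upwards [hinv'] with y hy g
    exact ⟨(continuous_const_smul g).measurable, hy g⟩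
  have hfib : ∀ᵐ y ∂π, ∀ᵐ x ∂(μy y), p x = y := by
    filter_upwards [hfiber] with y hy
    have := hprob y
    exact (mem_ae_iff_prob_eq_one (hp (measurableSet_singleton y))).2 hy
  have hmap : Measure.map p μ = π := by
    ext B hB
    rw [Measure.map_apply hp hB, hdecomp _ (hp hB), ← lintegral_indicator_one hB]
    refine lintegral_congr_ae ?_
    filter_upwards [hfib] with y hy
    have := hprob y
    by_cases hyB : y ∈ B
    · rw [indicator_of_mem hyB, Pi.one_apply]
      have : p ⁻¹' B =ᵐ[μy y] univ := by
        refine eventuallyEq_univ.2 ?_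
        filter_upwards [hy] with x hx
        change p x ∈ B
        rwa [hx]
      rw [measure_congr this, measure_univ]
    · rw [indicator_of_notMem hyB]
      refine measure_eq_zero_iff_ae_notMem.2 ?_
      filter_upwards [hy] with x hx
      change ¬ (p x ∈ B)
      rwa [hx]
  have hsupp : ∀ᵐ y ∂π, ∀ᵐ x ∂(μy y), ∀ U ∈ 𝓝 x, 0 < μ U := by
    have hm : MeasurableSet (μ.supportᶜ) := Measure.isOpen_compl_support.measurableSet
    have h0 : ∫⁻ y, μy y (μ.supportᶜ) ∂π = 0 := by
      rw [← hdecomp _ hm]; exact Measure.measure_compl_support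
    rw [lintegral_eq_zero_iff' (hmeas _ hm)] at h0
    filter_upwards [h0] with y hy
    have h1 : ∀ᵐ x ∂(μy y), x ∈ μ.support := hy
    filter_upwards [h1] with x hx
    exact (Measure.mem_support_iff_forall x).1 hx
  have hH : AEMeasurable (fun y => measEntropy F (μy y)) π :=
    measEntropy_aemeas π F hFol μy hprob hmeas hmp
  obtain ⟨h', hh'm, hh'⟩ := hH
  have hN : ∀ᵐ x ∂μ, h' (p x) ≤ lleC F μ x := by
    have hNm : MeasurableSet {x | lleC F μ x < h' (p x)} :=
      measurableSet_lt (lleC_meas F μ) (hh'm.comp hp)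
    have h0 : μ {x | lleC F μ x < h' (p x)} = 0 := by
      rw [hdecomp _ hNm, lintegral_eq_zero_iff' (hmeas _ hNm)]
      filter_upwards [hh', hmp, hfib, hsupp, herg] with y h1 h2 h3 h4 h5
      have := hprob y
      refine measure_eq_zero_iff_ae_notMem.2 ?_
      filter_upwards [h3, h4, thmA h2 h5 F hFol hTemp hGrow μ h4] with x hx1 hx2 hx3
      change ¬ (lleC F μ x < h' (p x))
      rw [not_lt, hx1, ← h1]
      exact hx3.trans (le_lleC F μ x hx2)
    filter_upwards [measure_eq_zero_iff_ae_notMem.1 h0] with x hx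
    exact not_lt.1 hx
  have hhp : ∀ᵐ x ∂μ, measEntropy F (μy (p x)) = h' (p x) := by
    rw [← hmap] at hh'
    exact ae_of_ae_map hp.aemeasurable hh'
  have hSm : MeasurableSet {y | h' y < ENNReal.ofReal M} := measurableSet_lt hh'm measurable_const
  have e1 : ({y | measEntropy F (μy y) < ENNReal.ofReal M} : Set Y) =ᵐ[π]
      {y | h' y < ENNReal.ofReal M} := by
    filter_upwards [hh'] with y hy
    change (measEntropy F (μy y) < ENNReal.ofReal M) = (h' y < ENNReal.ofReal M)
    rw [hy]
  have e2 : ({x | measEntropy F (μy (p x)) < ENNReal.ofReal M} : Set X) =ᵐ[μ]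
      p ⁻¹' {y | h' y < ENNReal.ofReal M} := by
    filter_upwards [hhp] with x hx
    change (measEntropy F (μy (p x)) < ENNReal.ofReal M) = (h' (p x) < ENNReal.ofReal M)
    rw [hx]
  calc ∫⁻ y in {y | measEntropy F (μy y) < ENNReal.ofReal M}, measEntropy F (μy y) ∂π
      = ∫⁻ y in {y | h' y < ENNReal.ofReal M}, measEntropy F (μy y) ∂π := setLIntegral_congr e1
    _ = ∫⁻ y in {y | h' y < ENNReal.ofReal M}, h' y ∂π :=
        lintegral_congr_ae (ae_restrict_of_ae hh')
    _ = ∫⁻ x in p ⁻¹' {y | h' y < ENNReal.ofReal M}, h' (p x) ∂μ := by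
        rw [← hmap, setLIntegral_map hSm hh'm hp]
    _ ≤ ∫⁻ x in p ⁻¹' {y | h' y < ENNReal.ofReal M}, localLowerEntropy F μ x ∂μ := by
        refine lintegral_mono_ae (ae_restrict_of_ae ?_)
        filter_upwards [hN] with x hx
        exact hx.trans (lleC_le F μ x)
    _ = _ := (setLIntegral_congr e2).symm
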